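/- Let M be a positive integer and q ∈ (1, M+1]. If for every p ∈ (1, q) the Hausdorff dimension of π_{M+1}(U'_q \ U'_p) is strictly positive, then q belongs to the closure of U, q ≠ q', and q is not the right endpoint q_0^* of any connected component of (1, M+1) \ closure(U). -/

import Mathlib

open Set MeasureTheory Filter

noncomputable section

/-- The projection `π_q` of a digit sequence (0-indexed): `∑ d i / q^(i+1)`. -/
def piQ (q : ℝ) (d : ℕ → ℕ) : ℝ := ∑' i : ℕ, (d i : ℝ) / q ^ (i + 1)

/-- `d` is a `q`-expansion of `x` over the alphabet `{0,…,M}`. -/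
def IsExpansion (M : ℕ) (q x : ℝ) (d : ℕ → ℕ) : Prop :=
  (∀ i, d i ≤ M) ∧ piQ q d = x

/-- `U'_q`: digit sequences that are the unique `q`-expansion of their projection. -/
def UnivSeqs (M : ℕ) (q : ℝ) : Set (ℕ → ℕ) :=
  {d | (∀ i, d i ≤ M) ∧ ∀ e : ℕ → ℕ, IsExpansion M q (piQ q d) e → e = d}

/-- The set `U = U(M)` of univoque bases: `q ∈ (1, M+1]` such that `1` has a
unique `q`-expansion over `{0,…,M}`. -/
def UnivBases (M : ℕ) : Set ℝ :=
  {q | 1 < q ∧ q ≤ M + 1 ∧ ∃! d : ℕ → ℕ, IsExpansion M q 1 d}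

/-- The Komornik–Loreti constant `q'(M) = min U(M)`. -/
def KL (M : ℕ) : ℝ := sInf (UnivBases M)

/-- `(a, b)` is a connected component of `(q'(M), M+1) \ closure (U(M))`:
an open subinterval whose endpoints do not lie in that (open) set. -/
def CC (M : ℕ) (a b : ℝ) : Prop :=
  a < b ∧ Ioo a b ⊆ Ioo (KL M) (M + 1) \ closure (UnivBases M) ∧
    a ∉ Ioo (KL M) (M + 1) \ closure (UnivBases M) ∧
    b ∉ Ioo (KL M) (M + 1) \ closure (UnivBases M)

/-- `x ∈ [0, M/(q-1)]` has exactly two distinct `q`-expansions. -/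
def HasExactlyTwoExpansions (M : ℕ) (q x : ℝ) : Prop :=
  ∃ c d : ℕ → ℕ, c ≠ d ∧ IsExpansion M q x c ∧ IsExpansion M q x d ∧
    ∀ e : ℕ → ℕ, IsExpansion M q x e → e = c ∨ e = d

/-- `B_2(M)`: bases `q ∈ (1, M+1]` for which some `x ∈ [0, M/(q-1)]` has exactly
two `q`-expansions. -/
def B2 (M : ℕ) : Set ℝ :=
  {q | 1 < q ∧ q ≤ M + 1 ∧
    ∃ x ∈ Icc (0 : ℝ) (M / (q - 1)), HasExactlyTwoExpansions M q x}

/-- Strict lexicographic order on digit sequences. -/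
def seqLt (a b : ℕ → ℕ) : Prop := ∃ n, (∀ i < n, a i = b i) ∧ a n < b n

/-- Lexicographic order on digit sequences. -/
def seqLe (a b : ℕ → ℕ) : Prop := seqLt a b ∨ a = b

/-- A digit sequence is infinite if it does not end with `0^∞` after a last
nonzero digit (in particular `0^∞` is infinite). -/
def IsInfiniteSeq (a : ℕ → ℕ) : Prop := ¬∃ m, a m ≠ 0 ∧ ∀ i > m, a i = 0

/-- `a = α(q)`, the quasi-greedy `q`-expansion of `1`: the lexicographically
largest infinite `q`-expansion of `1`. -/
def IsQuasiGreedy (M : ℕ) (q : ℝ) (a : ℕ → ℕ) : Prop :=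
  IsExpansion M q 1 a ∧ IsInfiniteSeq a ∧
    ∀ b : ℕ → ℕ, IsExpansion M q 1 b → IsInfiniteSeq b → seqLe b a

/-- `b = β(q)`, the greedy `q`-expansion of `1`: the lexicographically largest
`q`-expansion of `1`. -/
def IsGreedy (M : ℕ) (q : ℝ) (b : ℕ → ℕ) : Prop :=
  IsExpansion M q 1 b ∧ ∀ c : ℕ → ℕ, IsExpansion M q 1 c → seqLe c b

/-- `w⁺`: increase the last digit of a word by one. -/
def plusWord : List ℕ → List ℕ
  | [] => []
  | [a] => [a + 1]
  | a :: b :: rest => a :: plusWord (b :: rest)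

/-- `w⁻`: decrease the last digit of a word by one. -/
def minusWord : List ℕ → List ℕ
  | [] => []
  | [a] => [a - 1]
  | a :: b :: rest => a :: minusWord (b :: rest)

/-- The reflection of a word: `\overline{w} = (M - w_1) ⋯ (M - w_k)`. -/
def reflWord (M : ℕ) (w : List ℕ) : List ℕ := w.map fun a => M - a

/-- The substitution `g(w) = w⁺ \overline{w⁺}`. -/
def gWord (M : ℕ) (w : List ℕ) : List ℕ := plusWord w ++ reflWord M (plusWord w)

/-- The periodic sequence `t^∞` determined by a word `t`. -/
def periodicSeq (t : List ℕ) (i : ℕ) : ℕ := t.getD (i % t.length) 0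

/-- Strict lexicographic order on words. -/
def wordLt (u v : List ℕ) : Prop := List.Lex (· < ·) u v

/-- Lexicographic order on words. -/
def wordLe (u v : List ℕ) : Prop := wordLt u v ∨ u = v

/-- The connected component `(q_0, q_0^*)` of `(q'(M), M+1) \ closure (U(M))` is
generated by the word `t`, and `θ = α(q_0^*)`: `α(q_0) = t^∞` and
`α(q_0^*) = lim_{n→∞} g^n(t)`, i.e. every `g^n(t)` is a prefix of `θ`. -/
def GeneratedBy (M : ℕ) (q₀ q₀star : ℝ) (t : List ℕ) (θ : ℕ → ℕ) : Prop :=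
  CC M q₀ q₀star ∧ t ≠ [] ∧ IsQuasiGreedy M q₀ (periodicSeq t) ∧
    IsQuasiGreedy M q₀star θ ∧
    ∀ n : ℕ, ∀ i < ((gWord M)^[n] t).length, ((gWord M)^[n] t).getD i 0 = θ i

/-- The signed shift `s · σⁿ x` of an integer sequence. -/
def signedShift (s : ℤˣ) (n : ℕ) (x : ℕ → ℤ) : ℕ → ℤ := fun i => (s : ℤ) * x (i + n)

/-- `x` and `y` have the same first `N` terms. -/
def Agree (N : ℕ) (x y : ℕ → ℤ) : Prop := ∀ i < N, x i = y i

/-- Strict lexicographic order on integer sequences. -/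
def LexLT (x y : ℕ → ℤ) : Prop := ∃ n, Agree n x y ∧ x n < y n

/-- Strict lexicographic order on the first `N` terms. -/
def PrefixLT (N : ℕ) (x y : ℕ → ℤ) : Prop := ∃ n < N, Agree n x y ∧ x n < y n

/-- `x` is lexicographically larger than all its proper signed shifts. -/
def StrictPeak (x : ℕ → ℤ) : Prop := ∀ s n, 1 ≤ n → LexLT (signedShift s n x) x

/-- Sequences over `D` that start with the first `N` terms of `v`, and all whose windows of
length `N` are, up to sign, at most this prefix. -/
def peaked (D : Set ℤ) (N : ℕ) (v : ℕ → ℤ) : Set (ℕ → ℤ) :=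
  {z | (∀ i, z i ∈ D) ∧ Agree N z v ∧ ∀ s n, ¬ PrefixLT N v (signedShift s n z)}

/-- The index `i` is covered by the initial segment of `z` that ends with the first signed
reoccurrence of the first `N` terms of `v`. -/
def BeforeReturn (N : ℕ) (v z : ℕ → ℤ) (i : ℕ) : Prop :=
  ∀ n, 1 ≤ n → n + N ≤ i → ∀ s, ¬ Agree N (signedShift s n z) v

theorem signedShift_signedShift (s t : ℤˣ) (m n : ℕ) (x : ℕ → ℤ) :
    signedShift s n (signedShift t m x) = signedShift (s * t) (n + m) x := by
  funext i
  simp [signedShift, mul_assoc, add_assoc]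

theorem signedShift_one_zero (x : ℕ → ℤ) : signedShift 1 0 x = x := by
  funext i
  simp [signedShift]

theorem Agree.symm {N : ℕ} {x y : ℕ → ℤ} (h : Agree N x y) : Agree N y x :=
  fun i hi => (h i hi).symm

theorem Agree.trans {N : ℕ} {x y z : ℕ → ℤ} (h : Agree N x y) (h' : Agree N y z) :
    Agree N x z :=
  fun i hi => (h i hi).trans (h' i hi)

theorem Agree.mono {N K : ℕ} {x y : ℕ → ℤ} (h : Agree N x y) (hK : K ≤ N) : Agree K x y :=
  fun i hi => h i (hi.trans_le hK)

theorem exists_first_diff {x y : ℕ → ℤ} {k : ℕ} (h : x k ≠ y k) :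
    ∃ j ≤ k, Agree j x y ∧ x j ≠ y j := by
  classical
  have hex : ∃ j, x j ≠ y j := ⟨k, h⟩
  exact ⟨Nat.find hex, Nat.find_min' hex h, fun i hi => not_not.1 (Nat.find_min hex hi),
    Nat.find_spec hex⟩

theorem prefix_trichotomy (N : ℕ) (x y : ℕ → ℤ) :
    Agree N x y ∨ PrefixLT N x y ∨ PrefixLT N y x := by
  by_cases h : Agree N x y
  · exact Or.inl h
  · simp only [Agree, not_forall] at h
    obtain ⟨k, hk, hne⟩ := h
    obtain ⟨j, hj, ha, hd⟩ := exists_first_diff hne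
    rcases lt_or_gt_of_ne hd with h | h
    · exact Or.inr (Or.inl ⟨j, by omega, ha, h⟩)
    · exact Or.inr (Or.inr ⟨j, by omega, ha.symm, h⟩)

theorem lex_trichotomy {x y : ℕ → ℤ} (h : x ≠ y) : LexLT x y ∨ LexLT y x := by
  obtain ⟨k, hk⟩ := Function.ne_iff.1 h
  obtain ⟨j, -, ha, hd⟩ := exists_first_diff hk
  rcases lt_or_gt_of_ne hd with h | h
  · exact Or.inl ⟨j, ha, h⟩
  · exact Or.inr ⟨j, ha.symm, h⟩

theorem PrefixLT.lexLT {N : ℕ} {x y : ℕ → ℤ} (h : PrefixLT N x y) : LexLT x y := by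
  obtain ⟨n, -, h⟩ := h
  exact ⟨n, h⟩

theorem LexLT.trans {x y z : ℕ → ℤ} (h : LexLT x y) (h' : LexLT y z) : LexLT x z := by
  obtain ⟨n, ha, hn⟩ := h
  obtain ⟨m, hb, hm⟩ := h'
  rcases lt_trichotomy n m with hnm | rfl | hnm
  · exact ⟨n, ha.trans (hb.mono hnm.le), by rw [← hb n hnm]; exact hn⟩
  · exact ⟨n, ha.trans hb, hn.trans hm⟩
  · exact ⟨m, (ha.mono hnm.le).trans hb, by rw [ha m hnm]; exact hm⟩

theorem LexLT.irrefl (x : ℕ → ℤ) : ¬ LexLT x x := fun ⟨_, _, h⟩ => lt_irrefl _ h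

theorem PrefixLT.congr {N : ℕ} {x x' y y' : ℕ → ℤ} (h : PrefixLT N x y) (hx : Agree N x x')
    (hy : Agree N y y') : PrefixLT N x' y' := by
  obtain ⟨n, hnN, ha, hn⟩ := h
  refine ⟨n, hnN, fun i hi => ?_, ?_⟩
  · rw [← hx i (hi.trans hnN), ← hy i (hi.trans hnN), ha i hi]
  · rwa [← hx n hnN, ← hy n hnN]

theorem Agree.signedShift {N n : ℕ} {x y : ℕ → ℤ} (s : ℤˣ) (h : Agree (n + N) x y) :
    Agree N (signedShift s n x) (signedShift s n y) := fun i hi => by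
  simp only [_root_.signedShift]
  rw [h (i + n) (by omega)]

theorem peaked_signedShift {D : Set ℤ} (hD : ∀ s : ℤˣ, ∀ a ∈ D, (s : ℤ) * a ∈ D) {N : ℕ}
    {v z : ℕ → ℤ} (hz : z ∈ peaked D N v) {s : ℤˣ} {n : ℕ}
    (h : Agree N (signedShift s n z) v) : signedShift s n z ∈ peaked D N v :=
  ⟨fun _ => hD _ _ (hz.1 _), h, fun t m => by
    rw [signedShift_signedShift]; exact hz.2.2 _ _⟩

/-- Following forever the path of `w` to its first return. -/
theorem exists_loop {D : Set ℤ} (hD : ∀ s : ℤˣ, ∀ a ∈ D, (s : ℤ) * a ∈ D) {N : ℕ}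
    (hN : 0 < N) {v w : ℕ → ℤ} (hv : 0 < v 0) (hw : w ∈ peaked D N v) :
    ∃ g ∈ peaked D N v, ∀ s n, Agree N (signedShift s n g) v →
      ∀ i, BeforeReturn N v w i → signedShift s n g i = w i := by
  classical
  have sign_one : ∀ {s : ℤˣ} {g : ℕ → ℤ}, g 0 = v 0 → (s : ℤ) * g 0 = v 0 → s = 1 := by
    intro s g h0 h1
    rcases Int.units_eq_one_or s with rfl | rfl
    · rfl
    · simp at h1; omega
  by_cases hex : ∃ n, 1 ≤ n ∧ ∃ s, Agree N (signedShift s n w) v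
  · set τ := Nat.find hex with hτ
    obtain ⟨hτ1, t, ht⟩ := Nat.find_spec hex
    rw [← hτ] at hτ1 ht
    have hmin : ∀ n, 1 ≤ n → n < τ → ∀ s, ¬ Agree N (signedShift s n w) v := fun n h1 h2 s hs =>
      Nat.find_min hex h2 ⟨h1, s, hs⟩
    set g : ℕ → ℤ := fun i => ((t ^ (i / τ) : ℤˣ) : ℤ) * w (i % τ) with hg
    have hshift : ∀ k i, g (i + k * τ) = ((t ^ k : ℤˣ) : ℤ) * g i := by
      intro k i
      simp only [hg]
      rw [Nat.add_mul_mod_self_right, Nat.add_mul_div_right _ _ hτ1, pow_add]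
      push_cast
      ring
    have htt : (t : ℤ) * t = 1 := by
      rcases Int.units_eq_one_or t with rfl | rfl <;> simp
    have hgw : Agree (τ + N) g w := by
      intro i
      induction i using Nat.strong_induction_on with
      | _ i ih =>
        intro hi
        by_cases hiτ : i < τ
        · simp [hg, Nat.div_eq_of_lt hiτ, Nat.mod_eq_of_lt hiτ]
        · obtain ⟨m, rfl⟩ : ∃ m, i = m + τ := ⟨i - τ, by omega⟩
          have h1 := hshift 1 m
          rw [one_mul, pow_one, ih m (by omega) (by omega)] at h1
          have h2 := ht m (by omega)
          rw [← hw.2.1 m (by omega)] at h2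
          simp only [signedShift] at h2
          rw [h1, ← h2, ← mul_assoc, htt, one_mul]
    have hwin : ∀ s n, signedShift s n g = signedShift (s * t ^ (n / τ)) (n % τ) g := by
      intro s n
      funext i
      simp only [signedShift]
      have := hshift (n / τ) (i + n % τ)
      rw [add_assoc, mul_comm, Nat.mod_add_div] at this
      rw [this]
      push_cast
      ring
    have hwin' : ∀ s n, Agree N (signedShift s n g)
        (signedShift (s * t ^ (n / τ)) (n % τ) w) := by
      intro s n
      rw [hwin]
      exact Agree.signedShift _ (hgw.mono (by have := Nat.mod_lt n hτ1; omega))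
    refine ⟨g, ⟨fun i => hD _ _ (hw.1 _), (hgw.mono (by omega)).trans hw.2.1, fun s n h => ?_⟩,
      fun s n h i hi => ?_⟩
    · exact hw.2.2 _ _ (h.congr (fun _ _ => rfl) (hwin' s n))
    · have hr := (hwin' s n).symm.trans h
      have hr0 : n % τ = 0 := by
        by_contra h0
        exact hmin _ (by omega) (Nat.mod_lt n hτ1) _ hr
      have hs : s * t ^ (n / τ) = 1 := by
        have := hr 0 hN
        rw [hr0] at this
        exact sign_one (hw.2.1 0 hN) this
      rw [hwin, hr0, hs, signedShift_one_zero]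
      refine hgw i ?_
      by_contra hcon
      exact hi τ hτ1 (by omega) t ht
  · push Not at hex
    refine ⟨w, hw, fun s n h i _ => ?_⟩
    rcases Nat.eq_zero_or_pos n with rfl | hn
    · have := h 0 hN
      rw [sign_one (hw.2.1 0 hN) this, signedShift_one_zero]
    · exact absurd h (hex n hn s)

/-- Two elements of `peaked D N v` that differ before their first return can be spliced to a
strict peak which follows the larger one until its first return. -/
theorem exists_strictPeak_of_split {D : Set ℤ} (hD : ∀ s : ℤˣ, ∀ a ∈ D, (s : ℤ) * a ∈ D)
    {N : ℕ} (hN : 0 < N) {v z w : ℕ → ℤ} (hz : z ∈ peaked D N v) (hw : w ∈ peaked D N v)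
    {j : ℕ} (hag : Agree j w z) (hlt : w j < z j) (hj : BeforeReturn N v z j) :
    ∃ e ∈ peaked D N v, StrictPeak e ∧ ∀ i, BeforeReturn N v z i → e i = z i := by
  classical
  have hv : 0 < v 0 := by
    by_contra hv
    have key : ∀ y ∈ peaked D N v, y j = 0 := by
      intro y hy
      have h1 : ∀ s : ℤˣ, (s : ℤ) * y j ≤ v 0 := by
        intro s
        by_contra hcon
        refine hy.2.2 s j ⟨0, hN, fun i hi => absurd hi (Nat.not_lt_zero _), ?_⟩
        simpa [signedShift] using hcon
      have h2 := h1 1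
      have h3 := h1 (-1)
      simp at h2 h3
      omega
    rw [key z hz, key w hw] at hlt
    exact lt_irrefl _ hlt
  have hjw : BeforeReturn N v w j := fun n h1 h2 s h => hj n h1 h2 s
    ((Agree.signedShift s (hag.symm.mono h2)).trans h)
  have hlt' : ∀ {e u : ℕ → ℤ}, e ∈ peaked D N v → ¬ PrefixLT N v u → ¬ Agree N u v →
      LexLT u e := by
    intro e u he h1 h2
    rcases prefix_trichotomy N u v with h | h | h
    · exact absurd h h2
    · exact (h.congr (fun _ _ => rfl) he.2.1.symm).lexLT
    · exact absurd h h1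
  by_cases hex : ∃ n, 1 ≤ n ∧ ∃ s, Agree N (signedShift s n z) v
  · obtain ⟨g, hgp, hg⟩ := exists_loop hD hN hv hw
    set τ := Nat.find hex with hτ
    obtain ⟨hτ1, t, ht⟩ := Nat.find_spec hex
    rw [← hτ] at hτ1 ht
    have hmin : ∀ n, 1 ≤ n → n < τ → ∀ s, ¬ Agree N (signedShift s n z) v := fun n h1 h2 s hs =>
      Nat.find_min hex h2 ⟨h1, s, hs⟩
    have htt : (t : ℤ) * t = 1 := by
      rcases Int.units_eq_one_or t with rfl | rfl <;> simp
    set e : ℕ → ℤ := fun i => if i < τ then z i else (t : ℤ) * g (i - τ) with he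
    have hez : Agree (τ + N) e z := by
      intro i hi
      by_cases hiτ : i < τ
      · simp [he, hiτ]
      · obtain ⟨m, rfl⟩ : ∃ m, i = m + τ := ⟨i - τ, by omega⟩
        have h2 := ht m (by omega)
        rw [← hgp.2.1 m (by omega)] at h2
        simp only [signedShift] at h2
        simp only [he, hiτ, if_false, Nat.add_sub_cancel]
        rw [← h2, ← mul_assoc, htt, one_mul]
    have heg : ∀ s n, τ ≤ n → signedShift s n e = signedShift (s * t) (n - τ) g := by
      intro s n hn
      funext i
      simp only [signedShift, he]
      rw [if_neg (by omega), show i + n - τ = i + (n - τ) by omega]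
      push_cast
      ring
    have hep : e ∈ peaked D N v := by
      refine ⟨fun i => ?_, (hez.mono (by omega)).trans hz.2.1, fun s n h => ?_⟩
      · simp only [he]
        split_ifs
        · exact hz.1 i
        · exact hD _ _ (hgp.1 _)
      · by_cases hn : n < τ
        · exact hz.2.2 s n (h.congr (fun _ _ => rfl) (Agree.signedShift s (hez.mono (by omega))))
        · rw [heg s n (by omega)] at h
          exact hgp.2.2 _ _ h
    have hbe : ∀ i, BeforeReturn N v z i → e i = z i := by
      intro i hi
      refine hez i ?_
      by_contra hcon
      exact hi τ hτ1 (by omega) t ht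
    refine ⟨e, hep, fun s n hn => ?_, hbe⟩
    by_cases hag' : Agree N (signedShift s n e) v
    · by_cases hnτ : n < τ
      · exact absurd ((Agree.signedShift s (hez.symm.mono (by omega))).trans hag')
          (hmin n hn hnτ s)
      · rw [heg s n (by omega)] at hag' ⊢
        have hgw := hg _ _ hag'
        refine ⟨j, fun i hi => ?_, ?_⟩
        · rw [hgw i fun n h1 h2 => hjw n h1 (by omega), hag i hi,
            hbe i fun n h1 h2 => hj n h1 (by omega)]
        · rw [hgw j hjw, hbe j hj]
          exact hlt
    · exact hlt' hep (hep.2.2 s n) hag'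
  · push Not at hex
    exact ⟨z, hz, fun s n hn => hlt' hz (hz.2.2 s n) (hex n hn s), fun _ _ => rfl⟩

theorem exists_strictPeak_of_ne {D : Set ℤ} (hD : ∀ s : ℤˣ, ∀ a ∈ D, (s : ℤ) * a ∈ D)
    {N : ℕ} (hN : 0 < N) {v z w : ℕ → ℤ} (hz : z ∈ peaked D N v) (hw : w ∈ peaked D N v)
    (hne : z ≠ w) : ∃ e ∈ peaked D N v, StrictPeak e := by
  classical
  have hex : ∃ j, ∃ z ∈ peaked D N v, ∃ w ∈ peaked D N v, Agree j z w ∧ z j ≠ w j := by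
    obtain ⟨k, hk⟩ := Function.ne_iff.1 hne
    obtain ⟨j, -, ha, hd⟩ := exists_first_diff hk
    exact ⟨j, z, hz, w, hw, ha, hd⟩
  obtain ⟨z, hz, w, hw, ha, hd⟩ := Nat.find_spec hex
  have hret : ∀ y ∈ peaked D N v, Agree (Nat.find hex) y z →
      BeforeReturn N v y (Nat.find hex) := by
    intro y hy hyz n h1 h2 s hs
    have hsz := (Agree.signedShift s (hyz.symm.mono h2)).trans hs
    have hsw := (Agree.signedShift s ((hyz.trans ha).symm.mono h2)).trans hs
    refine Nat.find_min hex (m := Nat.find hex - n) (by omega)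
      ⟨_, peaked_signedShift hD hz hsz, _, peaked_signedShift hD hw hsw,
        Agree.signedShift s (ha.mono (by omega)), ?_⟩
    simp only [signedShift]
    rw [Nat.sub_add_cancel (by omega)]
    intro h
    exact hd (mul_left_cancel₀ (Units.ne_zero s) h)
  rcases lt_or_gt_of_ne hd with h | h
  · obtain ⟨e, he, hs, -⟩ := exists_strictPeak_of_split hD hN hw hz ha h (hret w hw ha.symm)
    exact ⟨e, he, hs⟩
  · obtain ⟨e, he, hs, -⟩ := exists_strictPeak_of_split hD hN hz hw ha.symm h
      (hret z hz fun _ _ => rfl)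
    exact ⟨e, he, hs⟩

theorem exists_prefix_max {S : Set (ℕ → ℤ)} (hS : S.Nonempty) {b : ℤ}
    (hb : ∀ x ∈ S, ∀ i, x i ≤ b) (N : ℕ) : ∃ y ∈ S, ∀ u ∈ S, ¬ PrefixLT N y u := by
  induction N with
  | zero =>
    obtain ⟨y, hy⟩ := hS
    exact ⟨y, hy, fun u _ ⟨n, hn, _⟩ => absurd hn (Nat.not_lt_zero _)⟩
  | succ N ih =>
    obtain ⟨y, hy, hmax⟩ := ih
    obtain ⟨m, ⟨z, hz, hzy, rfl⟩, hm⟩ := Int.exists_greatest_of_bdd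
      (P := fun m => ∃ z ∈ S, Agree N z y ∧ z N = m)
      ⟨b, fun m ⟨z, hz, _, h⟩ => h ▸ hb z hz N⟩ ⟨y N, y, hy, fun _ _ => rfl, rfl⟩
    refine ⟨z, hz, fun u hu ⟨n, hn, ha, hlt⟩ => ?_⟩
    rcases Nat.lt_succ_iff_lt_or_eq.1 hn with hn | rfl
    · exact hmax u hu (PrefixLT.congr ⟨n, hn, ha, hlt⟩ hzy fun _ _ => rfl)
    · exact absurd (hm _ ⟨u, hu, ha.symm.trans hzy, rfl⟩) (not_le.2 hlt)

theorem PrefixLT.mono {N K : ℕ} {x y : ℕ → ℤ} (h : PrefixLT N x y) (hK : N ≤ K) :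
    PrefixLT K x y := by
  obtain ⟨n, hn, h⟩ := h
  exact ⟨n, hn.trans_le hK, h⟩

theorem not_prefixLT_of_lexLT {N : ℕ} {x y : ℕ → ℤ} (h : LexLT x y) : ¬ PrefixLT N y x :=
  fun h' => LexLT.irrefl _ (h.trans h'.lexLT)

/-- A set `X` of sequences over `D`, closed under signed shifts and lying strictly below `A`, such
that no strict peak below `A` starts with the first `N₀` terms of `A`. -/
structure PeakFree (D : Set ℤ) (X : Set (ℕ → ℤ)) (A : ℕ → ℤ) (N₀ : ℕ) : Prop where
  smul_mem : ∀ s : ℤˣ, ∀ a ∈ D, (s : ℤ) * a ∈ D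
  bddAbove : BddAbove D
  pos : 0 < N₀
  digit_mem : ∀ x ∈ X, ∀ i, x i ∈ D
  shift_mem : ∀ x ∈ X, ∀ s n, signedShift s n x ∈ X
  lexLT : ∀ x ∈ X, LexLT x A
  not_strictPeak : ∀ e : ℕ → ℤ, (∀ i, e i ∈ D) → StrictPeak e → LexLT e A → ¬ Agree N₀ e A

/-- The elements of `X` that start like `A` up to `N₀`, but not up to `N`, and whose prefix of
length `N` dominates all windows. -/
def lowPeaks (X : Set (ℕ → ℤ)) (A : ℕ → ℤ) (N₀ N : ℕ) : Set (ℕ → ℤ) :=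
  {y ∈ X | Agree N₀ y A ∧ ¬ Agree N y A ∧ ∀ s n, ¬ PrefixLT N y (signedShift s n y)}

namespace PeakFree

variable {D : Set ℤ} {X : Set (ℕ → ℤ)} {A : ℕ → ℤ} {N₀ : ℕ}

theorem eq_of_mem_lowPeaks (h : PeakFree D X A N₀) {N : ℕ} (hN : N₀ ≤ N) {x y : ℕ → ℤ}
    (hx : x ∈ lowPeaks X A N₀ N) (hy : y ∈ lowPeaks X A N₀ N) (hxy : Agree N x y) : x = y := by
  by_contra hne
  have hxp : x ∈ peaked D N x := ⟨h.digit_mem x hx.1, fun _ _ => rfl, hx.2.2.2⟩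
  have hyp : y ∈ peaked D N x := ⟨h.digit_mem y hy.1, hxy.symm, fun s n hlt =>
    hy.2.2.2 s n (hlt.congr hxy fun _ _ => rfl)⟩
  obtain ⟨e, he, hs⟩ := exists_strictPeak_of_ne h.smul_mem (h.pos.trans_le hN) hxp hyp hne
  have hlt : PrefixLT N x A := by
    rcases prefix_trichotomy N x A with h' | h' | h'
    · exact absurd h' hx.2.2.1
    · exact h'
    · exact absurd h' (not_prefixLT_of_lexLT (h.lexLT x hx.1))
  exact h.not_strictPeak e he.1 hs (hlt.congr he.2.1.symm fun _ _ => rfl).lexLT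
    ((he.2.1.mono hN).trans hx.2.1)

theorem exists_signedShift_mem (h : PeakFree D X A N₀) {N : ℕ} (hN : N₀ ≤ N) {x : ℕ → ℤ}
    (hx : x ∈ X) (hxA : Agree N₀ x A) :
    ∃ s n, signedShift s n x ∈ X ∧ (Agree N (signedShift s n x) A ∨
      signedShift s n x ∈ lowPeaks X A N₀ N) := by
  by_cases hex : ∃ s n, Agree N (signedShift s n x) A
  · obtain ⟨s, n, hs⟩ := hex
    exact ⟨s, n, h.shift_mem x hx s n, Or.inl hs⟩
  push Not at hex
  obtain ⟨b, hb⟩ := h.bddAbove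
  obtain ⟨_, ⟨s, n, rfl⟩, hmax⟩ := exists_prefix_max
    (S := {y | ∃ s n, y = signedShift s n x}) ⟨_, 1, 0, rfl⟩ (b := b)
    (by
      rintro _ ⟨s, n, rfl⟩ i
      exact hb (h.digit_mem _ (h.shift_mem x hx s n) i)) N
  have hmem := h.shift_mem x hx s n
  refine ⟨s, n, hmem, Or.inr ⟨hmem, ?_, hex s n, fun t m => ?_⟩⟩
  · rcases prefix_trichotomy N₀ (signedShift s n x) A with h' | h' | h'
    · exact h'
    · exact absurd ((h'.congr (fun _ _ => rfl) hxA.symm).mono hN)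
        (hmax x ⟨1, 0, (signedShift_one_zero x).symm⟩)
    · exact absurd h' (not_prefixLT_of_lexLT (h.lexLT _ hmem))
  · exact hmax _ ⟨_, _, signedShift_signedShift _ _ _ _ _⟩

theorem mem_peaked (h : PeakFree D X A N₀) {N : ℕ} {x : ℕ → ℤ} (hx : x ∈ X)
    (hxA : Agree N x A) : x ∈ peaked D N A :=
  ⟨h.digit_mem x hx, hxA, fun s n => not_prefixLT_of_lexLT (h.lexLT _ (h.shift_mem x hx s n))⟩

theorem exists_code_of_no_overlap (h : PeakFree D X A N₀) {N L : ℕ} (hN : N₀ ≤ N)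
    (hL : ∀ (s : ℤˣ) (n : ℕ), 1 ≤ n → (∀ i, i + n < N → A (i + n) = (s : ℤ) * A i) → L ≤ n) :
    ∃ code : (ℕ → ℤ) → ℕ → Bool, ∀ x ∈ X, ∀ y ∈ X, Agree N x A → Agree N y A →
      ∀ k, (∀ i < k, code x i = code y i) → Agree (k * L) x y := by
  classical
  have hN' : 0 < N := h.pos.trans_le hN
  set F : Set (ℕ → ℤ) := {x ∈ X | Agree N x A} with hF
  let bit : (ℕ → ℤ) → Bool := fun x =>
    decide (∃ y ∈ F, ∃ j, Agree j x y ∧ x j < y j ∧ BeforeReturn N A x j)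
  have nosplit : ∀ x ∈ F, ∀ y ∈ F, bit x = bit y → ∀ j, Agree j x y → x j < y j →
      ¬ BeforeReturn N A x j := by
    intro x hx y hy hbit j hxy hlt hret
    have hbx : bit x = true := by
      simp only [bit, decide_eq_true_eq]
      exact ⟨y, hy, j, hxy, hlt, hret⟩
    rw [hbit] at hbx
    simp only [bit, decide_eq_true_eq] at hbx
    obtain ⟨z, hz, k, hyz, hk, hretk⟩ := hbx
    obtain ⟨e, he, hs, hey⟩ := exists_strictPeak_of_split h.smul_mem hN' (h.mem_peaked hy.1 hy.2)
      (h.mem_peaked hx.1 hx.2) hxy hlt fun n h1 h2 s hs =>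
        hret n h1 h2 s ((Agree.signedShift s (hxy.mono h2)).trans hs)
    refine h.not_strictPeak e he.1 hs (LexLT.trans ?_ (h.lexLT z hz.1)) (he.2.1.mono hN)
    refine ⟨k, fun i hi => ?_, ?_⟩
    · rw [hey i fun n h1 h2 => hretk n h1 (by omega), hyz i hi]
    · rwa [hey k hretk]
  have nosplit' : ∀ x ∈ F, ∀ y ∈ F, bit x = bit y → ∀ j, Agree j x y → x j ≠ y j →
      ¬ BeforeReturn N A x j := by
    intro x hx y hy hbit j hxy hne hret
    rcases lt_or_gt_of_ne hne with hlt | hlt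
    · exact nosplit x hx y hy hbit j hxy hlt hret
    · exact nosplit y hy x hx hbit.symm j hxy.symm hlt fun n h1 h2 s hs =>
        hret n h1 h2 s ((Agree.signedShift s (hxy.mono h2)).trans hs)
  have hstep : ∀ b : Bool, ∃ (s : ℤˣ) (τ : ℕ), ∀ x ∈ F, ∀ y ∈ F, bit x = b → bit y = b →
      x = y ∨ (L ≤ τ ∧ Agree τ x y ∧ signedShift s τ x ∈ F ∧ signedShift s τ y ∈ F) := by
    intro b
    by_cases hex : ∃ n, 1 ≤ n ∧ ∃ x ∈ F, bit x = b ∧ ∃ s, Agree N (signedShift s n x) A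
    · obtain ⟨hτ, z, hz, hzb, s, hs⟩ := Nat.find_spec hex
      set τ := Nat.find hex with hτdef
      have hall : ∀ x ∈ F, bit x = b → Agree (τ + N) x z := by
        intro x hx hxb i hi
        by_contra hne
        obtain ⟨j, hj, ha, hd⟩ := exists_first_diff hne
        refine nosplit' x hx z hz (hxb.trans hzb.symm) j ha hd fun n h1 h2 t ht => ?_
        exact Nat.find_min hex (m := n) (by omega) ⟨h1, x, hx, hxb, t, ht⟩
      have hmem : ∀ x ∈ F, bit x = b → signedShift s τ x ∈ F := fun x hx hxb =>
        ⟨h.shift_mem x hx.1 s τ, (Agree.signedShift s (hall x hx hxb)).trans hs⟩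
      refine ⟨s, τ, fun x hx y hy hxb hyb => Or.inr ⟨hL s τ hτ fun i hi => ?_,
        ((hall x hx hxb).trans (hall y hy hyb).symm).mono (by omega), hmem x hx hxb,
        hmem y hy hyb⟩⟩
      have h1 := hs i (by omega)
      simp only [signedShift] at h1
      rw [← h1, hz.2 (i + τ) hi, ← mul_assoc]
      rcases Int.units_eq_one_or s with rfl | rfl <;> simp
    · push Not at hex
      refine ⟨1, 0, fun x hx y hy hxb hyb => Or.inl ?_⟩
      by_contra hne
      obtain ⟨k, hk⟩ := Function.ne_iff.1 hne
      obtain ⟨j, -, ha, hd⟩ := exists_first_diff hk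
      exact nosplit' x hx y hy (hxb.trans hyb.symm) j ha hd fun n h1 _ s => hex n h1 x hx hxb s
  choose s τ hsτ using hstep
  let next : (ℕ → ℤ) → (ℕ → ℤ) := fun x => signedShift (s (bit x)) (τ (bit x)) x
  refine ⟨fun x i => bit (next^[i] x), fun x hx y hy hxA hyA k => ?_⟩
  have main : ∀ k, ∀ x ∈ F, ∀ y ∈ F, (∀ i < k, bit (next^[i] x) = bit (next^[i] y)) →
      Agree (k * L) x y := by
    intro k
    induction k with
    | zero =>
      intro x _ y _ _ i hi
      simp at hi
    | succ k ih =>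
      intro x hx y hy hc
      have hb : bit x = bit y := hc 0 (Nat.succ_pos k)
      rcases hsτ (bit y) x hx y hy hb rfl with rfl | ⟨h1, h2, h3, h4⟩
      · exact fun _ _ => rfl
      · have hnx : next x = signedShift (s (bit y)) (τ (bit y)) x := by
          simp only [next, hb]
        have hagree := ih _ h3 _ h4 fun i hi => by
          have := hc (i + 1) (by omega)
          rwa [Function.iterate_succ_apply, Function.iterate_succ_apply, hnx] at this
        intro i hi
        by_cases hiτ : i < τ (bit y)
        · exact h2 i hiτ
        · rw [add_mul, one_mul] at hi
          have := hagree (i - τ (bit y)) (by omega)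
          simp only [signedShift] at this
          rw [Nat.sub_add_cancel (by omega)] at this
          exact mul_left_cancel₀ (Units.ne_zero _) this
  exact main k x ⟨hx, hxA⟩ y ⟨hy, hyA⟩

theorem exists_not_agree_of_periodic (h : PeakFree D X A N₀) {s : ℤˣ} {l : ℕ} (hl : 1 ≤ l)
    (hA : ∀ i, A (i + l) = (s : ℤ) * A i) : ∃ N ≥ N₀, ∀ x ∈ X, ¬ Agree N x A := by
  refine ⟨max N₀ l + l, by omega, fun x hx hxA => ?_⟩
  obtain ⟨j, ha, hlt⟩ := h.lexLT x hx
  have hj : l ≤ j := by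
    by_contra hj
    exact hlt.ne (hxA j (by omega))
  rcases Int.units_eq_one_or s with rfl | rfl
  · simp only [Units.val_one, one_mul] at hA
    have hx' : signedShift 1 l x ∈ peaked D (max N₀ l) A := by
      refine h.mem_peaked (h.shift_mem x hx 1 l) fun i hi => ?_
      simp only [signedShift, Units.val_one, one_mul]
      rw [hxA (i + l) (by omega), hA]
    have hne : x ≠ signedShift 1 l x := by
      intro heq
      have h1 : x j = x (j - l) := by
        have := congrFun heq (j - l)
        simp only [signedShift, Units.val_one, one_mul] at this
        rw [Nat.sub_add_cancel hj] at this
        exact this.symm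
      have h2 := hA (j - l)
      rw [Nat.sub_add_cancel hj] at h2
      rw [h1, h2, ha (j - l) (by omega)] at hlt
      exact lt_irrefl _ hlt
    obtain ⟨e, he, hs⟩ := exists_strictPeak_of_ne h.smul_mem (by omega)
      (h.mem_peaked hx (hxA.mono (by omega))) hx' hne
    have heA : LexLT e A := by
      have hsl := hs 1 l hl
      by_cases heq : e = A
      · subst heq
        obtain ⟨n, -, hn⟩ := hsl
        simp [signedShift, hA] at hn
      · rcases lex_trichotomy heq with h' | ⟨n, hn, hlt'⟩
        · exact h'
        · have hln : l ≤ n := by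
            by_contra hln
            exact hlt'.ne' (he.2.1 n (by omega))
          refine absurd (hsl.trans ⟨n - l, fun i hi => ?_, ?_⟩) (LexLT.irrefl _)
          · simp only [signedShift, Units.val_one, one_mul]
            rw [← hn (i + l) (by omega), ← hn i (by omega), hA]
          · simp only [signedShift, Units.val_one, one_mul]
            have h2 := hA (n - l)
            rw [Nat.sub_add_cancel hln] at h2 ⊢
            rw [← hn (n - l) (by omega), ← h2]
            exact hlt'
    exact h.not_strictPeak e he.1 hs heA (he.2.1.mono (by omega))
  · simp only [Units.val_neg, Units.val_one, neg_mul, one_mul] at hA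
    refine absurd ((h.lexLT _ (h.shift_mem x hx (-1) l)).trans ⟨j - l, fun i hi => ?_, ?_⟩)
      (LexLT.irrefl _)
    · simp only [signedShift, Units.val_neg, Units.val_one, neg_mul, one_mul]
      rw [ha (i + l) (by omega), hA, neg_neg]
    · simp only [signedShift, Units.val_neg, Units.val_one, neg_mul, one_mul]
      have h2 := hA (j - l)
      rw [Nat.sub_add_cancel hj] at h2 ⊢
      omega

theorem exists_code (h : PeakFree D X A N₀) (L : ℕ) :
    ∃ N ≥ N₀, ∃ code : (ℕ → ℤ) → ℕ → Bool, ∀ x ∈ X, ∀ y ∈ X, Agree N x A → Agree N y A →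
      ∀ k, (∀ i < k, code x i = code y i) → Agree (k * L) x y := by
  by_cases hper : ∃ (s : ℤˣ) (l : ℕ), 1 ≤ l ∧ ∀ i, A (i + l) = (s : ℤ) * A i
  · obtain ⟨s, l, hl, hA⟩ := hper
    obtain ⟨N, hN, hempty⟩ := h.exists_not_agree_of_periodic hl hA
    exact ⟨N, hN, fun _ _ => true, fun x hx _ _ hxA => absurd hxA (hempty x hx)⟩
  · push Not at hper
    choose! f hf using hper
    let N := N₀ + ∑ n ∈ Finset.range L, (f 1 n + n + 1 + (f (-1) n + n + 1))
    refine ⟨N, Nat.le_add_right _ _, h.exists_code_of_no_overlap (Nat.le_add_right _ _)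
      fun s n hn hov => ?_⟩
    by_contra hcon
    have hle : f 1 n + n + 1 + (f (-1) n + n + 1) ≤ N :=
      (Finset.single_le_sum (f := fun n => f 1 n + n + 1 + (f (-1) n + n + 1))
        (fun _ _ => Nat.zero_le _) (Finset.mem_range.2 (not_le.1 hcon))).trans
        (Nat.le_add_left _ _)
    refine hf s n hn (hov _ ?_)
    rcases Int.units_eq_one_or s with rfl | rfl <;> omega

end PeakFree

section Projection

variable {M : ℕ} {p q : ℝ} {c d e : ℕ → ℕ}

theorem summable_digits (hq : 1 < q) (hc : ∀ i, c i ≤ M) :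
    Summable fun i => (c i : ℝ) / q ^ (i + 1) := by
  have hq0 : 0 < q := by linarith
  have hs : Summable fun i : ℕ => (M : ℝ) * (q⁻¹) ^ i :=
    (summable_geometric_of_lt_one (by positivity) (inv_lt_one_of_one_lt₀ hq)).mul_left _
  refine Summable.of_nonneg_of_le (fun i => by positivity) (fun i => ?_) hs
  rw [inv_pow, ← div_eq_mul_inv]
  have : (c i : ℝ) ≤ M := by exact_mod_cast hc i
  gcongr
  · exact hq.le
  · omega

theorem piQ_nonneg (hq : 1 < q) : 0 ≤ piQ q c :=
  tsum_nonneg fun i => by positivity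

theorem piQ_pos (hq : 1 < q) (hc : ∀ i, c i ≤ M) {k : ℕ} (hk : c k ≠ 0) : 0 < piQ q c := by
  have hk' : (0 : ℝ) < c k := by exact_mod_cast Nat.pos_of_ne_zero hk
  exact (summable_digits hq hc).tsum_pos (fun i => by positivity) k (by positivity)

theorem piQ_eq_sum_add (hq : 1 < q) (hc : ∀ i, c i ≤ M) (n : ℕ) :
    piQ q c = ∑ i ∈ Finset.range n, (c i : ℝ) / q ^ (i + 1) +
      piQ q (fun i => c (i + n)) / q ^ n := by
  have hq0 : 0 < q := by linarith
  rw [piQ, ← (summable_digits hq hc).sum_add_tsum_nat_add n, piQ, ← tsum_div_const]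
  congr 2
  funext i
  rw [div_div, ← pow_add]
  congr 2
  ring

theorem piQ_eq_head_add (hq : 1 < q) (hc : ∀ i, c i ≤ M) (n : ℕ) :
    q * piQ q (fun i => c (i + n)) = c n + piQ q (fun i => c (i + (n + 1))) := by
  have hq0 : 0 < q := by linarith
  rw [piQ_eq_sum_add hq (fun i => hc (i + n)) 1]
  simp only [Finset.sum_range_one, zero_add, pow_one, add_assoc, add_comm 1 n]
  field_simp

theorem piQ_of_orbit (hq : 1 < q) {a : ℕ → ℕ} {x : ℕ → ℝ} {b : ℝ} (hb : ∀ n, |x n| ≤ b)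
    (hx : ∀ n, x (n + 1) = q * x n - a n) : piQ q a = x 0 := by
  have hq0 : 0 < q := by linarith
  have hsum : ∀ n, ∑ i ∈ Finset.range n, (a i : ℝ) / q ^ (i + 1) = x 0 - x n / q ^ n := by
    intro n
    induction n with
    | zero => simp
    | succ n ih =>
      rw [Finset.sum_range_succ, ih, hx]
      field_simp
      ring
  refine HasSum.tsum_eq ((hasSum_iff_tendsto_nat_of_nonneg (fun i => by positivity) _).2 ?_)
  simp only [hsum]
  have h0 : Tendsto (fun n => x n / q ^ n) atTop (nhds 0) := by
    have hlim : Tendsto (fun n : ℕ => b * (q⁻¹) ^ n) atTop (nhds 0) := by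
      simpa using (tendsto_pow_atTop_nhds_zero_of_lt_one (by positivity)
        (inv_lt_one_of_one_lt₀ hq)).const_mul b
    refine squeeze_zero_norm (fun n => ?_) hlim
    rw [Real.norm_eq_abs, abs_div, abs_of_pos (pow_pos hq0 n), inv_pow, ← div_eq_mul_inv]
    gcongr
    exact hb n
  simpa using h0.const_sub (x 0)

theorem piQ_const (hq : 1 < q) : piQ q (fun _ => M) = M / (q - 1) := by
  have h1 : q - 1 ≠ 0 := by linarith
  exact piQ_of_orbit hq (x := fun _ => (M : ℝ) / (q - 1)) (fun _ => le_rfl) fun n => by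
    field_simp
    ring

theorem piQ_refl (hq : 1 < q) (hc : ∀ i, c i ≤ M) :
    piQ q (fun i => M - c i) = M / (q - 1) - piQ q c := by
  rw [← piQ_const hq, piQ, piQ, piQ,
    ← (summable_digits (M := M) hq fun _ => le_rfl).tsum_sub (summable_digits hq hc)]
  congr 1
  funext i
  rw [Nat.cast_sub (hc i), sub_div]

theorem piQ_le (hq : 1 < q) (hc : ∀ i, c i ≤ M) : piQ q c ≤ M / (q - 1) := by
  have := piQ_refl hq hc
  have := piQ_nonneg (c := fun i => M - c i) hq
  linarith

theorem exists_isExpansion (hq : 1 < q) (hqM : q ≤ M + 1) {x : ℝ} (hx : 0 ≤ x)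
    (hx' : x ≤ M / (q - 1)) : ∃ a, IsExpansion M q x a := by
  have hq1 : 0 < q - 1 := by linarith
  let f : ℝ → ℝ := fun y => q * y - (min ⌊q * y⌋₊ M : ℕ)
  have hf : ∀ y, 0 ≤ y → y ≤ M / (q - 1) → 0 ≤ f y ∧ f y ≤ M / (q - 1) := by
    intro y h0 h1
    have hqy : 0 ≤ q * y := by positivity
    have hfl := Nat.floor_le hqy
    have hfl' := Nat.lt_floor_add_one (q * y)
    rw [le_div_iff₀ hq1] at h1 ⊢
    simp only [f]
    rcases le_total ⌊q * y⌋₊ M with h | h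
    · rw [min_eq_left h]
      refine ⟨by linarith, ?_⟩
      nlinarith
    · rw [min_eq_right h]
      have : (M : ℝ) ≤ ⌊q * y⌋₊ := by exact_mod_cast h
      refine ⟨by linarith, ?_⟩
      nlinarith
  have horb : ∀ n, 0 ≤ f^[n] x ∧ f^[n] x ≤ M / (q - 1) := by
    intro n
    induction n with
    | zero => exact ⟨hx, hx'⟩
    | succ n ih =>
      rw [Function.iterate_succ_apply']
      exact hf _ ih.1 ih.2
  refine ⟨fun n => min ⌊q * f^[n] x⌋₊ M, fun n => min_le_right _ _, ?_⟩
  exact piQ_of_orbit hq (x := fun n => f^[n] x)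
    (fun n => by rw [abs_of_nonneg (horb n).1]; exact (horb n).2) fun n => by
    rw [Function.iterate_succ_apply']

theorem piQ_anti (hp : 1 < p) (hpq : p ≤ q) (hc : ∀ i, c i ≤ M) : piQ q c ≤ piQ p c := by
  refine (summable_digits (hp.trans_le hpq) hc).tsum_le_tsum (fun i => ?_) (summable_digits hp hc)
  have : 0 < p := by linarith
  gcongr

theorem piQ_strictAnti (hp : 1 < p) (hpq : p < q) (hc : ∀ i, c i ≤ M) {k : ℕ}
    (hk : c k ≠ 0) : piQ q c < piQ p c := by
  have hp0 : 0 < p := by linarith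
  have hk' : (0 : ℝ) < c k := by exact_mod_cast Nat.pos_of_ne_zero hk
  refine (summable_digits (hp.trans hpq) hc).tsum_lt_tsum (i := k) (fun i => ?_) ?_
    (summable_digits hp hc)
  · gcongr
  · gcongr

theorem continuousOn_piQ (hp : 1 < p) (hc : ∀ i, c i ≤ M) :
    ContinuousOn (fun r => piQ r c) (Ici p) := by
  refine continuousOn_tsum (u := fun i => (c i : ℝ) / p ^ (i + 1)) (fun i => ?_)
    (summable_digits hp hc) fun i r hr => ?_
  · refine ContinuousOn.div continuousOn_const (continuousOn_id.pow _) fun r hr => ?_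
    have hr' : p ≤ r := hr
    have hr0 : r ≠ 0 := by linarith
    exact pow_ne_zero _ hr0
  · have hr' : p ≤ r := hr
    have hp0 : 0 < p := by linarith
    have hr0 : 0 < r := by linarith
    rw [Real.norm_eq_abs, abs_of_nonneg (by positivity)]
    gcongr

/-- The sequence `c` shifted `n` times, and reflected if `s = -1`. -/
def signedTail (M : ℕ) (s : ℤˣ) (n : ℕ) (c : ℕ → ℕ) : ℕ → ℕ :=
  fun i => if s = 1 then c (i + n) else M - c (i + n)

theorem signedTail_one (n : ℕ) : signedTail M 1 n c = fun i => c (i + n) := by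
  funext i
  simp [signedTail]

theorem signedTail_neg_one (n : ℕ) : signedTail M (-1) n c = fun i => M - c (i + n) := by
  funext i
  have : (-1 : ℤˣ) ≠ 1 := by decide
  simp [signedTail, this]

theorem signedTail_le (hc : ∀ i, c i ≤ M) (s : ℤˣ) (n i : ℕ) : signedTail M s n c i ≤ M := by
  unfold signedTail
  split_ifs
  · exact hc _
  · exact Nat.sub_le _ _

/-- Replacing one digit by a smaller one or a larger one is impossible in a unique expansion. -/
theorem not_exchange (hq : 1 < q) (hqM : q ≤ M + 1) (hc : c ∈ UnivSeqs M q) {n k : ℕ}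
    (hk : k ≤ M) (hkn : k ≠ c n) :
    ¬ (0 ≤ (c n : ℝ) - k + piQ q (fun i => c (i + (n + 1))) ∧
      (c n : ℝ) - k + piQ q (fun i => c (i + (n + 1))) ≤ M / (q - 1)) := by
  rintro ⟨h0, h1⟩
  have hq0 : 0 < q := by linarith
  obtain ⟨a, ha, hax⟩ := exists_isExpansion hq hqM h0 h1
  let e : ℕ → ℕ := fun i => if i < n then c i else if i = n then k else a (i - (n + 1))
  have heM : ∀ i, e i ≤ M := by
    intro i
    simp only [e]
    split_ifs
    · exact hc.1 i
    · exact hk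
    · exact ha _
  have hen : e n = k := by simp [e]
  have htail : (fun i => e (i + (n + 1))) = a := by
    funext i
    simp only [e]
    rw [if_neg (by omega), if_neg (by omega), Nat.add_sub_cancel]
  have heq : e = c := by
    refine hc.2 e ⟨heM, ?_⟩
    rw [piQ_eq_sum_add hq heM (n + 1), piQ_eq_sum_add hq hc.1 (n + 1), htail, hax,
      Finset.sum_range_succ, Finset.sum_range_succ, hen]
    have : ∑ i ∈ Finset.range n, (e i : ℝ) / q ^ (i + 1) =
        ∑ i ∈ Finset.range n, (c i : ℝ) / q ^ (i + 1) :=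
      Finset.sum_congr rfl fun i hi => by simp [e, Finset.mem_range.1 hi]
    rw [this]
    ring
  exact hkn (by rw [← hen, heq])

theorem piQ_tail_lt_one (hq : 1 < q) (hqM : q ≤ M + 1) (hc : c ∈ UnivSeqs M q) {n : ℕ}
    (hn : c n < M) : piQ q (fun i => c (i + (n + 1))) < 1 := by
  by_contra hcon
  have h1 := piQ_le hq fun i => hc.1 (i + (n + 1))
  refine not_exchange hq hqM hc (n := n) (k := c n + 1) hn (by omega) ⟨?_, ?_⟩ <;>
    push_cast <;> linarith

theorem piQ_refl_tail_lt_one (hq : 1 < q) (hqM : q ≤ M + 1) (hc : c ∈ UnivSeqs M q) {n : ℕ}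
    (hn : 0 < c n) : piQ q (fun i => M - c (i + (n + 1))) < 1 := by
  by_contra hcon
  rw [piQ_refl hq fun i => hc.1 (i + (n + 1))] at hcon
  have h0 := piQ_nonneg (c := fun i => c (i + (n + 1))) hq
  have := hc.1 n
  refine not_exchange hq hqM hc (n := n) (k := c n - 1) (by omega) (by omega) ⟨?_, ?_⟩ <;>
    rw [Nat.cast_sub hn] <;> push_cast <;> linarith

theorem tail_lt_one_of_lt (hq : 1 < q) (hqM : q ≤ M + 1) (hc : c ∈ UnivSeqs M q) {n m : ℕ}
    (hn : c n < M) (hnm : n < m) : piQ q (fun i => c (i + m)) < 1 := by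
  induction m, hnm using Nat.le_induction with
  | base => exact piQ_tail_lt_one hq hqM hc hn
  | succ m hm ih =>
    rcases (hc.1 m).lt_or_eq with h | h
    · exact piQ_tail_lt_one hq hqM hc h
    · have := piQ_eq_head_add hq hc.1 m
      rw [h] at this
      nlinarith

theorem refl_tail_lt_one_of_lt (hq : 1 < q) (hqM : q ≤ M + 1) (hc : c ∈ UnivSeqs M q) {n m : ℕ}
    (hn : 0 < c n) (hnm : n < m) : piQ q (fun i => M - c (i + m)) < 1 := by
  induction m, hnm using Nat.le_induction with
  | base => exact piQ_refl_tail_lt_one hq hqM hc hn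
  | succ m hm ih =>
    rcases Nat.eq_zero_or_pos (c m) with h | h
    · have := piQ_eq_head_add (c := fun i => M - c i) hq (fun i => Nat.sub_le _ _) m
      simp only [h, Nat.sub_zero] at this
      nlinarith
    · exact piQ_refl_tail_lt_one hq hqM hc h

theorem first_diff_nat (h : c ≠ d) : ∃ n, (∀ i < n, c i = d i) ∧ c n ≠ d n := by
  classical
  have hex := Function.ne_iff.1 h
  exact ⟨Nat.find hex, fun i hi => not_not.1 (Nat.find_min hex hi), Nat.find_spec hex⟩

theorem piQ_sub_of_prefix (hq : 1 < q) (hc : ∀ i, c i ≤ M) (hd : ∀ i, d i ≤ M) {n : ℕ}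
    (h : ∀ i < n, c i = d i) :
    piQ q c - piQ q d = ((c n : ℝ) - d n + piQ q (fun i => c (i + (n + 1))) -
      piQ q (fun i => d (i + (n + 1)))) / q ^ (n + 1) := by
  rw [piQ_eq_sum_add hq hc (n + 1), piQ_eq_sum_add hq hd (n + 1), Finset.sum_range_succ,
    Finset.sum_range_succ]
  have : ∑ i ∈ Finset.range n, (c i : ℝ) / q ^ (i + 1) =
      ∑ i ∈ Finset.range n, (d i : ℝ) / q ^ (i + 1) :=
    Finset.sum_congr rfl fun i hi => by rw [h i (Finset.mem_range.1 hi)]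
  rw [this]
  ring

theorem exists_tail_of_not_mem (hp : 1 < p) (hc : ∀ i, c i ≤ M) (hcp : c ∉ UnivSeqs M p) :
    ∃ n, (c n < M ∧ 1 ≤ piQ p (fun i => c (i + (n + 1)))) ∨
      (0 < c n ∧ 1 ≤ piQ p (fun i => M - c (i + (n + 1)))) := by
  have hp0 : 0 < p := by linarith
  simp only [UnivSeqs, mem_ofPred_eq, not_and, not_forall] at hcp
  obtain ⟨e, ⟨heM, hec⟩, hne⟩ := hcp hc
  obtain ⟨n, ha, hd⟩ := first_diff_nat hne
  have h1 := piQ_sub_of_prefix hp heM hc ha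
  rw [hec, sub_self, eq_comm, div_eq_zero_iff, or_iff_left (by positivity)] at h1
  have h2 := piQ_nonneg (c := fun i => e (i + (n + 1))) hp
  have h3 := piQ_le hp fun i => heM (i + (n + 1))
  refine ⟨n, ?_⟩
  rcases lt_or_gt_of_ne hd with h | h
  · right
    refine ⟨by omega, ?_⟩
    rw [piQ_refl hp fun i => hc (i + (n + 1))]
    have : (e n : ℝ) + 1 ≤ c n := by exact_mod_cast h
    linarith
  · left
    refine ⟨h.trans_le (heM n), ?_⟩
    have : (c n : ℝ) + 1 ≤ e n := by exact_mod_cast h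
    linarith

end Projection

section Bases

variable {M : ℕ} {p q r : ℝ} {a c d e : ℕ → ℕ}

/-- A sequence all whose shifts are lexicographically smaller than an expansion `a` of `1` without
vanishing tail represents a number smaller than `1`. -/
theorem piQ_lt_one_of_seqLt (hr : 1 < r) (ha : ∀ i, a i ≤ M) (ha1 : piQ r a = 1)
    (hpos : ∀ j, 0 < piQ r fun i => a (i + j)) (he : ∀ i, e i ≤ M)
    (hlt : ∀ n, seqLt (fun i => e (i + n)) a) : piQ r e < 1 := by
  have hr0 : 0 < r := by linarith
  have hr1 : 0 < r - 1 := by linarith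
  have step : ∀ n, ∃ j, piQ r (fun i => e (i + n)) - 1 ≤
      (piQ r (fun i => e (i + (n + (j + 1)))) - 1 - piQ r (fun i => a (i + (j + 1)))) /
        r ^ (j + 1) := by
    intro n
    obtain ⟨j, hj, hj'⟩ := hlt n
    refine ⟨j, ?_⟩
    have h1 := piQ_sub_of_prefix hr (fun i => he (i + n)) ha hj
    rw [ha1] at h1
    rw [h1]
    have h2 : (fun i => e (i + (j + 1) + n)) = fun i => e (i + (n + (j + 1))) := by
      funext i
      congr 1
      omega
    rw [h2]
    have h3 : (e (j + n) : ℝ) + 1 ≤ a j := by exact_mod_cast hj'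
    gcongr
    linarith
  have hbound : ∀ k n, piQ r (fun i => e (i + n)) - 1 ≤ M / (r - 1) * (r⁻¹) ^ k := by
    intro k
    induction k with
    | zero =>
      intro n
      have := piQ_le hr fun i => he (i + n)
      simp only [pow_zero, mul_one]
      linarith
    | succ k ih =>
      intro n
      obtain ⟨j, hj⟩ := step n
      have hC : 0 ≤ M / (r - 1) * (r⁻¹) ^ k := by positivity
      have h1 : piQ r (fun i => e (i + (n + (j + 1)))) - 1 -
          piQ r (fun i => a (i + (j + 1))) ≤ M / (r - 1) * (r⁻¹) ^ k := by
        linarith [ih (n + (j + 1)), hpos (j + 1)]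
      calc _ ≤ _ := hj
        _ ≤ M / (r - 1) * (r⁻¹) ^ k / r ^ (j + 1) := by gcongr
        _ ≤ M / (r - 1) * (r⁻¹) ^ k / r := by
          gcongr
          exact le_self_pow₀ hr.le (by omega)
        _ = M / (r - 1) * (r⁻¹) ^ (k + 1) := by rw [pow_succ]; ring
  have hle : ∀ n, piQ r (fun i => e (i + n)) - 1 ≤ 0 := by
    intro n
    have hlim : Tendsto (fun k : ℕ => (M : ℝ) / (r - 1) * (r⁻¹) ^ k) atTop (nhds 0) := by
      simpa using (tendsto_pow_atTop_nhds_zero_of_lt_one (by positivity)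
        (inv_lt_one_of_one_lt₀ hr)).const_mul ((M : ℝ) / (r - 1))
    exact ge_of_tendsto' hlim fun k => hbound k n
  obtain ⟨j, hj⟩ := step 0
  have : (piQ r (fun i => e (i + (0 + (j + 1)))) - 1 - piQ r (fun i => a (i + (j + 1)))) /
      r ^ (j + 1) < 0 :=
    div_neg_of_neg_of_pos (by linarith [hle (0 + (j + 1)), hpos (j + 1)]) (by positivity)
  simp only [add_zero] at hj
  linarith

theorem exists_mem_univBases (hp : 1 < p) (hpq : p < q) (hqM : q ≤ M + 1)
    (he : ∀ i, e i ≤ M) (hpeak : ∀ s n, 1 ≤ n → seqLt (signedTail M s n e) e)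
    (heq : piQ q e < 1) (hep : 1 < piQ p e) : ∃ r ∈ Ioo p q, r ∈ UnivBases M := by
  obtain ⟨r, hr, hr1⟩ := intermediate_value_Ioo' hpq.le
    ((continuousOn_piQ hp he).mono Icc_subset_Ici_self) ⟨heq, hep⟩
  simp only at hr1
  have h1r : 1 < r := hp.trans hr.1
  have hpos : ∀ j, 0 < piQ r fun i => e (i + j) := by
    intro j
    by_cases hex : ∃ k, e (k + j) ≠ 0
    · obtain ⟨k, hk⟩ := hex
      exact piQ_pos h1r (fun i => he (i + j)) hk
    · push Not at hex
      obtain ⟨n, -, hn⟩ := hpeak (-1) (j + 1) (by omega)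
      rw [signedTail_neg_one] at hn
      have h0 := hex (n + 1)
      rw [add_assoc, add_comm 1 j] at h0
      simp only [h0] at hn
      have := he n
      omega
  refine ⟨r, hr, h1r, hr.2.le.trans hqM, e, ⟨he, hr1⟩, fun d hd => ?_⟩
  have huniv : e ∈ UnivSeqs M r := by
    by_contra hcon
    obtain ⟨n, ⟨-, h⟩ | ⟨-, h⟩⟩ := exists_tail_of_not_mem h1r he hcon
    · refine absurd (piQ_lt_one_of_seqLt h1r he hr1 hpos (fun i => he (i + (n + 1)))
        fun m => ?_) (not_lt.2 h)
      have := hpeak 1 (m + (n + 1)) (by omega)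
      rwa [signedTail_one, ← funext fun i => congrArg e (add_assoc i m (n + 1))] at this
    · refine absurd (piQ_lt_one_of_seqLt (M := M) h1r he hr1 hpos
        (e := fun i => M - e (i + (n + 1))) (fun i => Nat.sub_le _ _) fun m => ?_) (not_lt.2 h)
      have := hpeak (-1) (m + (n + 1)) (by omega)
      rwa [signedTail_neg_one,
        ← funext fun i => congrArg (fun k => M - e k) (add_assoc i m (n + 1))] at this
  exact huniv.2 d ⟨hd.1, hd.2.trans hr1.symm⟩

theorem exists_quasiGreedy (hq : 1 < q) (hqM : q ≤ M + 1) :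
    ∃ a : ℕ → ℕ, (∀ i, a i ≤ M) ∧ piQ q a = 1 ∧
      ∀ n, 0 < piQ q (fun i => a (i + n)) ∧ piQ q (fun i => a (i + n)) ≤ 1 := by
  let f : ℝ → ℝ := fun y => q * y - (⌈q * y⌉₊ - 1 : ℕ)
  have hf : ∀ y, 0 < y → y ≤ 1 → 0 < f y ∧ f y ≤ 1 := by
    intro y h0 h1
    have hqy : 0 < q * y := by positivity
    have h2 := Nat.le_ceil (q * y)
    have h3 := Nat.ceil_lt_add_one hqy.le
    have h4 : 1 ≤ ⌈q * y⌉₊ := Nat.ceil_pos.2 hqy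
    simp only [f]
    rw [Nat.cast_sub h4]
    push_cast
    constructor <;> linarith
  have horb : ∀ n, 0 < f^[n] 1 ∧ f^[n] 1 ≤ 1 := by
    intro n
    induction n with
    | zero => simp
    | succ n ih =>
      rw [Function.iterate_succ_apply']
      exact hf _ ih.1 ih.2
  let a : ℕ → ℕ := fun n => ⌈q * f^[n] 1⌉₊ - 1
  have htail : ∀ n, piQ q (fun i => a (i + n)) = f^[n] 1 := by
    intro n
    have := piQ_of_orbit hq (a := fun i => a (i + n)) (x := fun i => f^[i + n] 1) (b := 1)
      (fun i => by rw [abs_of_pos (horb _).1]; exact (horb _).2) fun i => by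
        rw [show i + 1 + n = (i + n) + 1 by omega, Function.iterate_succ_apply']
    simpa using this
  refine ⟨a, fun n => ?_, by simpa using htail 0, fun n => by rw [htail]; exact horb n⟩
  have h1 : ⌈q * f^[n] 1⌉₊ ≤ M + 1 := by
    refine Nat.ceil_le.2 ?_
    push_cast
    nlinarith [(horb n).1, (horb n).2]
  simp only [a]
  omega

theorem lt_quasiGreedy (hq : 1 < q) (ha : ∀ i, a i ≤ M) (ha1 : piQ q a = 1)
    (hle : ∀ n, piQ q (fun i => a (i + n)) ≤ 1) (hd : ∀ i, d i ≤ M)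
    (hd1 : ∀ n, piQ q (fun i => d (i + n)) < 1) {j : ℕ} (hj : ∀ i < j, d i = a i)
    (hne : d j ≠ a j) :
    d j < a j ∧ piQ q d ≤ 1 - piQ q (fun i => a (i + (j + 1))) / q ^ (j + 1) := by
  have hq0 : 0 < q := by linarith
  have h1 := piQ_sub_of_prefix hq hd ha hj
  have h2 : piQ q d < 1 := by simpa using hd1 0
  have h3 : (d j : ℝ) - a j + piQ q (fun i => d (i + (j + 1))) -
      piQ q (fun i => a (i + (j + 1))) < 0 := by
    by_contra hcon
    have : 0 ≤ piQ q d - piQ q a := by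
      rw [h1]
      exact div_nonneg (not_lt.1 hcon) (by positivity)
    linarith
  have h4 := piQ_nonneg (c := fun i => d (i + (j + 1))) hq
  have h5 : (d j : ℝ) < a j + 1 := by linarith [hle (j + 1)]
  have h6 : d j < a j := by
    have : d j < a j + 1 := by exact_mod_cast h5
    omega
  refine ⟨h6, ?_⟩
  have h7 : (d j : ℝ) + 1 ≤ a j := by exact_mod_cast h6
  have h8 : piQ q d - piQ q a ≤ (-piQ q (fun i => a (i + (j + 1)))) / q ^ (j + 1) := by
    rw [h1]
    gcongr
    linarith [hd1 (j + 1)]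
  rw [ha1, neg_div] at h8
  linarith

theorem eventually_piQ_lt (hq : 1 < q) {δ : ℝ} (hδ : 0 < δ) :
    ∀ᶠ p in nhdsWithin q (Iio q), ∀ d : ℕ → ℕ, (∀ i, d i ≤ M) → piQ p d < piQ q d + δ := by
  have hcont : ContinuousAt (fun p : ℝ => (M : ℝ) / (p - 1)) q :=
    ContinuousAt.div continuousAt_const (by fun_prop) (by linarith)
  have h1 : ∀ᶠ p in nhdsWithin q (Iio q), (M : ℝ) / (p - 1) < M / (q - 1) + δ :=
    (hcont.eventually (gt_mem_nhds (lt_add_of_pos_right _ hδ))).filter_mono nhdsWithin_le_nhds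
  have h2 : ∀ᶠ p in nhdsWithin q (Iio q), 1 < p :=
    (lt_mem_nhds hq).filter_mono nhdsWithin_le_nhds
  filter_upwards [h1, h2, self_mem_nhdsWithin] with p hp1 hp2 hpq d hd
  have h3 := piQ_anti (q := q) (c := fun i => M - d i) (M := M) hp2 (le_of_lt hpq)
    fun i => Nat.sub_le _ _
  rw [piQ_refl hp2 hd, piQ_refl hq hd] at h3
  linarith

end Bases

section Centering

variable {M : ℕ} {c d : ℕ → ℕ}

/-- The sequence with digits `2 cᵢ - M`, for which reflection is negation. -/
def centered (M : ℕ) (c : ℕ → ℕ) : ℕ → ℤ := fun i => 2 * (c i : ℤ) - M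

/-- The centered digits. -/
def centeredDigits (M : ℕ) : Set ℤ := {z | ∃ k ≤ M, z = 2 * (k : ℤ) - M}

theorem centered_eq_iff {i : ℕ} : centered M c i = centered M d i ↔ c i = d i := by
  simp only [centered]
  omega

theorem centered_lt_iff {i : ℕ} : centered M c i < centered M d i ↔ c i < d i := by
  simp only [centered]
  omega

theorem lexLT_centered_iff : LexLT (centered M c) (centered M d) ↔ seqLt c d := by
  simp only [LexLT, Agree, seqLt, centered_eq_iff, centered_lt_iff]

theorem centered_signedTail (hc : ∀ i, c i ≤ M) (s : ℤˣ) (n : ℕ) :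
    centered M (signedTail M s n c) = signedShift s n (centered M c) := by
  funext i
  have := hc (i + n)
  rcases Int.units_eq_one_or s with rfl | rfl
  · simp [signedTail_one, centered, signedShift]
  · simp only [signedTail_neg_one, centered, signedShift, Units.val_neg, Units.val_one]
    omega

theorem smul_mem_centeredDigits (s : ℤˣ) (z : ℤ) (hz : z ∈ centeredDigits M) :
    (s : ℤ) * z ∈ centeredDigits M := by
  obtain ⟨k, hk, rfl⟩ := hz
  rcases Int.units_eq_one_or s with rfl | rfl
  · exact ⟨k, hk, by simp⟩
  · exact ⟨M - k, Nat.sub_le _ _, by simp only [Units.val_neg, Units.val_one]; omega⟩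

theorem centered_mem (hc : ∀ i, c i ≤ M) (i : ℕ) : centered M c i ∈ centeredDigits M :=
  ⟨c i, hc i, rfl⟩

theorem exists_centered_eq {x : ℕ → ℤ} (hx : ∀ i, x i ∈ centeredDigits M) :
    ∃ c : ℕ → ℕ, (∀ i, c i ≤ M) ∧ centered M c = x := by
  choose c hc hcx using hx
  exact ⟨c, hc, funext fun i => (hcx i).symm⟩

theorem centered_injective : Function.Injective (centered M) := fun _ _ h =>
  funext fun i => centered_eq_iff.1 (congrFun h i)

theorem bddAbove_centeredDigits : BddAbove (centeredDigits M) :=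
  ⟨M, by rintro _ ⟨k, hk, rfl⟩; omega⟩

theorem signedTail_signedTail (hc : ∀ i, c i ≤ M) (s t : ℤˣ) (m n : ℕ) :
    signedTail M s n (signedTail M t m c) = signedTail M (s * t) (n + m) c := by
  apply centered_injective (M := M)
  rw [centered_signedTail (signedTail_le hc t m), centered_signedTail hc, centered_signedTail hc,
    signedShift_signedShift]

end Centering

section Dimension

variable {M : ℕ} {c d : ℕ → ℕ}

theorem piQ_refl_full (hM : 0 < M) (hc : ∀ i, c i ≤ M) :
    piQ ((M : ℝ) + 1) (fun i => M - c i) = 1 - piQ ((M : ℝ) + 1) c := by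
  have hM' : (0 : ℝ) < M := by exact_mod_cast hM
  rw [piQ_refl (by linarith) hc, add_sub_cancel_right, div_self hM'.ne']

theorem abs_piQ_sub_le (hM : 0 < M) (hc : ∀ i, c i ≤ M) (hd : ∀ i, d i ≤ M) {n : ℕ}
    (h : ∀ i < n, c i = d i) :
    |piQ ((M : ℝ) + 1) c - piQ ((M : ℝ) + 1) d| ≤ ((M : ℝ) + 1)⁻¹ ^ n := by
  have hM' : (0 : ℝ) < M := by exact_mod_cast hM
  have hb : (1 : ℝ) < (M : ℝ) + 1 := by linarith
  have hI : ∀ e : ℕ → ℕ, (∀ i, e i ≤ M) →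
      0 ≤ piQ ((M : ℝ) + 1) e ∧ piQ ((M : ℝ) + 1) e ≤ 1 := by
    intro e he
    have h1 := piQ_le hb he
    rw [add_sub_cancel_right, div_self hM'.ne'] at h1
    exact ⟨piQ_nonneg hb, h1⟩
  have hsum : ∑ i ∈ Finset.range n, (c i : ℝ) / ((M : ℝ) + 1) ^ (i + 1) =
      ∑ i ∈ Finset.range n, (d i : ℝ) / ((M : ℝ) + 1) ^ (i + 1) :=
    Finset.sum_congr rfl fun i hi => by rw [h i (Finset.mem_range.1 hi)]
  obtain ⟨h1, h2⟩ := hI _ fun i => hc (i + n)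
  obtain ⟨h3, h4⟩ := hI _ fun i => hd (i + n)
  rw [piQ_eq_sum_add hb hc n, piQ_eq_sum_add hb hd n, hsum, add_sub_add_left_eq_sub, ← sub_div,
    abs_div, abs_of_pos (pow_pos (by linarith : (0 : ℝ) < (M : ℝ) + 1) n), inv_pow,
    ← one_div]
  gcongr
  exact abs_sub_le_iff.2 ⟨by linarith, by linarith⟩

/-- A set of digit sequences in which one binary symbol determines `L` digits has a small image. -/
theorem dimH_image_piQ_le (hM : 0 < M) {L : ℕ} (hL : 1 ≤ L) {S : Set (ℕ → ℕ)}
    (hS : ∀ x ∈ S, ∀ i, x i ≤ M) (code : (ℕ → ℕ) → ℕ → Bool)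
    (hcode : ∀ x ∈ S, ∀ y ∈ S, ∀ k, (∀ i < k, code x i = code y i) → ∀ i < k * L, x i = y i) :
    dimH (piQ ((M : ℝ) + 1) '' S) ≤ (((L : NNReal)⁻¹ : NNReal) : ENNReal) := by
  have hM' : (1 : ℝ) ≤ M := by exact_mod_cast hM
  have hL0 : (L : ℝ) ≠ 0 := by positivity
  set b : ℝ := ((M : ℝ) + 1)⁻¹ with hb
  have hb0 : 0 ≤ b := by positivity
  have hb2 : 2 * b ≤ 1 := by
    rw [hb, ← div_eq_mul_inv, div_le_one (by linarith)]
    linarith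
  refine dimH_le_of_hausdorffMeasure_ne_top (ne_top_of_le_ne_top ENNReal.one_ne_top ?_)
  have hdiam : ∀ k (w : Fin k → Bool),
      Metric.ediam (piQ ((M : ℝ) + 1) '' {x ∈ S | ∀ i : Fin k, code x i = w i}) ≤
        ENNReal.ofReal (b ^ (k * L)) := by
    intro k w
    refine Metric.ediam_le ?_
    rintro _ ⟨x, ⟨hx, hxw⟩, rfl⟩ _ ⟨y, ⟨hy, hyw⟩, rfl⟩
    rw [edist_dist, Real.dist_eq]
    refine ENNReal.ofReal_le_ofReal (abs_piQ_sub_le hM (hS x hx) (hS y hy) ?_)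
    exact hcode x hx y hy k fun i hi => (hxw ⟨i, hi⟩).trans (hyw ⟨i, hi⟩).symm
  refine (Measure.hausdorffMeasure_le_liminf_sum (l := atTop) (ι := fun k => Fin k → Bool) _ _
    (fun k => ENNReal.ofReal (b ^ (k * L))) ?_
    (fun k w => piQ ((M : ℝ) + 1) '' {x ∈ S | ∀ i : Fin k, code x i = w i})
    (Eventually.of_forall hdiam) (Eventually.of_forall fun k => ?_)).trans ?_
  · rw [← ENNReal.ofReal_zero]
    refine ENNReal.tendsto_ofReal
      ((tendsto_pow_atTop_nhds_zero_of_lt_one hb0 (by linarith)).comp ?_)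
    exact tendsto_atTop_mono (fun k => Nat.le_mul_of_pos_right k hL) tendsto_id
  · rintro _ ⟨x, hx, rfl⟩
    exact mem_iUnion.2 ⟨fun i => code x i, x, ⟨hx, fun _ => rfl⟩, rfl⟩
  · refine liminf_le_of_frequently_le' (Eventually.of_forall fun k => ?_).frequently
    calc _ ≤ ∑ _w : Fin k → Bool, ENNReal.ofReal (b ^ k) := by
          refine Finset.sum_le_sum fun w _ => ?_
          refine (ENNReal.rpow_le_rpow (hdiam k w) (by positivity)).trans_eq ?_
          rw [ENNReal.ofReal_rpow_of_nonneg (by positivity) (by positivity), pow_mul,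
            NNReal.coe_inv, NNReal.coe_natCast,
            Real.pow_rpow_inv_natCast (by positivity) (by omega)]
      _ = ENNReal.ofReal ((2 * b) ^ k) := by
          rw [Finset.sum_const, Finset.card_univ, Fintype.card_fun, Fintype.card_bool,
            Fintype.card_fin, mul_pow, ENNReal.ofReal_mul (by positivity), nsmul_eq_mul]
          norm_num [ENNReal.ofReal_pow]
      _ ≤ 1 := by
          rw [← ENNReal.ofReal_one]
          exact ENNReal.ofReal_le_ofReal (pow_le_one₀ (by positivity) hb2)

theorem dimH_image_piQ_preimage_signedTail_le (hM : 0 < M) (S : Set (ℕ → ℕ)) (s : ℤˣ) (n : ℕ) :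
    dimH (piQ ((M : ℝ) + 1) '' {c | (∀ i, c i ≤ M) ∧ signedTail M s n c ∈ S}) ≤
      dimH (piQ ((M : ℝ) + 1) '' S) := by
  have hM' : (0 : ℝ) < M := by exact_mod_cast hM
  have hb : (1 : ℝ) < (M : ℝ) + 1 := by linarith
  let f : (Fin n → ℕ) → ℝ → ℝ := fun w y =>
    ∑ i : Fin n, (w i : ℝ) / ((M : ℝ) + 1) ^ ((i : ℕ) + 1) +
      (if s = 1 then y else 1 - y) / ((M : ℝ) + 1) ^ n
  have hf : ∀ w, LipschitzWith 1 (f w) := by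
    refine fun w => LipschitzWith.of_dist_le_mul fun x y => ?_
    rw [Real.dist_eq, Real.dist_eq, add_sub_add_left_eq_sub, ← sub_div, abs_div,
      abs_of_pos (pow_pos (by linarith : (0 : ℝ) < (M : ℝ) + 1) n), NNReal.coe_one, one_mul]
    have : |(if s = 1 then x else 1 - x) - (if s = 1 then y else 1 - y)| = |x - y| := by
      split_ifs
      · rfl
      · rw [sub_sub_sub_cancel_left, abs_sub_comm]
    rw [this]
    exact div_le_self (abs_nonneg _) (one_le_pow₀ hb.le)
  have hsub : piQ ((M : ℝ) + 1) '' {c | (∀ i, c i ≤ M) ∧ signedTail M s n c ∈ S} ⊆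
      ⋃ w, f w '' (piQ ((M : ℝ) + 1) '' S) := by
    rintro _ ⟨c, ⟨hc, hcS⟩, rfl⟩
    refine mem_iUnion.2 ⟨fun i => c i, _, ⟨_, hcS, rfl⟩, ?_⟩
    rw [piQ_eq_sum_add hb hc n, Finset.sum_range]
    rcases Int.units_eq_one_or s with rfl | rfl
    · simp [f, signedTail_one]
    · have h1 : (-1 : ℤˣ) ≠ 1 := by decide
      simp [f, signedTail_neg_one, h1, piQ_refl_full hM fun i => hc (i + n)]
  calc _ ≤ _ := dimH_mono hsub
    _ = ⨆ w, dimH (f w '' (piQ ((M : ℝ) + 1) '' S)) := dimH_iUnion _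
    _ ≤ _ := iSup_le fun w => (hf w).dimH_image_le _

theorem dimH_image_piQ_le_of_exists_signedTail (hM : 0 < M) {S T : Set (ℕ → ℕ)}
    (h : ∀ c ∈ T, (∀ i, c i ≤ M) ∧ ∃ s n, signedTail M s n c ∈ S) :
    dimH (piQ ((M : ℝ) + 1) '' T) ≤ dimH (piQ ((M : ℝ) + 1) '' S) := by
  have hsub : piQ ((M : ℝ) + 1) '' T ⊆ ⋃ (s : ℤˣ) (n : ℕ),
      piQ ((M : ℝ) + 1) '' {c | (∀ i, c i ≤ M) ∧ signedTail M s n c ∈ S} := by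
    rintro _ ⟨c, hc, rfl⟩
    obtain ⟨hcM, s, n, hs⟩ := h c hc
    exact mem_iUnion₂.2 ⟨s, n, c, ⟨hcM, hs⟩, rfl⟩
  refine (dimH_mono hsub).trans ?_
  simp only [dimH_iUnion]
  exact iSup₂_le fun s n => dimH_image_piQ_preimage_signedTail_le hM S s n

end Dimension

section Gap

variable {M : ℕ} {p q : ℝ} {a c d : ℕ → ℕ}

/-- The digit sequences all of whose tails and reflected tails project to `[0, 1)`. -/
def tailsBelowOne (M : ℕ) (q : ℝ) : Set (ℕ → ℕ) :=
  {d | (∀ i, d i ≤ M) ∧ ∀ s n, piQ q (signedTail M s n d) < 1}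

theorem tail_lt_one_of_mem (hd : d ∈ tailsBelowOne M q) (n : ℕ) :
    piQ q (fun i => d (i + n)) < 1 := by
  have := hd.2 1 n
  rwa [signedTail_one] at this

theorem signedTail_mem_tailsBelowOne (hd : d ∈ tailsBelowOne M q) (s : ℤˣ) (n : ℕ) :
    signedTail M s n d ∈ tailsBelowOne M q :=
  ⟨signedTail_le hd.1 s n, fun t m => by
    rw [signedTail_signedTail hd.1]
    exact hd.2 _ _⟩

theorem exists_prefix_one_lt {r : ℝ} (hr : 1 < r) (ha : ∀ i, a i ≤ M) (har : 1 < piQ r a) :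
    ∃ N, 0 < N ∧ ∀ e : ℕ → ℕ, (∀ i, e i ≤ M) → (∀ i < N, e i = a i) → 1 < piQ r e := by
  have hr0 : 0 < r := by linarith
  have hlim : Tendsto (fun n : ℕ => (M : ℝ) / (r - 1) * r⁻¹ ^ n) atTop (nhds 0) := by
    simpa using (tendsto_pow_atTop_nhds_zero_of_lt_one (inv_nonneg.2 hr0.le)
      (inv_lt_one_of_one_lt₀ hr)).const_mul ((M : ℝ) / (r - 1))
  obtain ⟨N, hN, hN0⟩ := ((hlim.eventually (gt_mem_nhds (sub_pos.2 har))).and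
    (eventually_gt_atTop 0)).exists
  refine ⟨N, hN0, fun e he hea => ?_⟩
  have hsum : ∑ i ∈ Finset.range N, (e i : ℝ) / r ^ (i + 1) =
      ∑ i ∈ Finset.range N, (a i : ℝ) / r ^ (i + 1) :=
    Finset.sum_congr rfl fun i hi => by rw [hea i (Finset.mem_range.1 hi)]
  have h1 := piQ_eq_sum_add hr ha N
  have h2 : piQ r (fun i => a (i + N)) / r ^ N ≤ (M : ℝ) / (r - 1) * r⁻¹ ^ N := by
    rw [inv_pow, ← div_eq_mul_inv]
    have := piQ_le hr fun i => ha (i + N)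
    gcongr
  have h3 : 0 ≤ piQ r (fun i => e (i + N)) / r ^ N := div_nonneg (piQ_nonneg hr) (by positivity)
  rw [piQ_eq_sum_add hr he N, hsum]
  linarith

theorem exists_peakFree {r : ℝ} (hr : 1 < r) (hrq : r < q) (hqM : q ≤ M + 1)
    (hU : ∀ x ∈ Ioo r q, x ∉ UnivBases M) (ha : ∀ i, a i ≤ M) (ha1 : piQ q a = 1)
    (htail : ∀ n, 0 < piQ q (fun i => a (i + n)) ∧ piQ q (fun i => a (i + n)) ≤ 1) :
    ∃ N, PeakFree (centeredDigits M) (centered M '' tailsBelowOne M q) (centered M a) N := by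
  have hq : 1 < q := hr.trans hrq
  have har : 1 < piQ r a := by
    obtain ⟨k, hk⟩ : ∃ k, a k ≠ 0 := by
      by_contra! h
      simp [piQ, h] at ha1
    exact ha1 ▸ piQ_strictAnti hr hrq ha hk
  obtain ⟨N, hN0, hN⟩ := exists_prefix_one_lt hr ha har
  refine ⟨N, smul_mem_centeredDigits, bddAbove_centeredDigits, hN0, ?_, ?_, ?_, ?_⟩
  · rintro _ ⟨d, hd, rfl⟩
    exact centered_mem hd.1
  · rintro _ ⟨d, hd, rfl⟩ s n
    exact ⟨_, signedTail_mem_tailsBelowOne hd s n, centered_signedTail hd.1 s n⟩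
  · rintro _ ⟨d, hd, rfl⟩
    have hda : d ≠ a := by
      rintro rfl
      have := tail_lt_one_of_mem hd 0
      simp only [add_zero] at this
      linarith
    obtain ⟨j, hj, hne⟩ := first_diff_nat hda
    exact lexLT_centered_iff.2
      ⟨j, hj, (lt_quasiGreedy hq ha ha1 (fun n => (htail n).2) hd.1 (tail_lt_one_of_mem hd)
        hj hne).1⟩
  · intro x hx hpeak hlt hagree
    obtain ⟨e, he, rfl⟩ := exists_centered_eq hx
    have hpeak' : ∀ s n, 1 ≤ n → seqLt (signedTail M s n e) e := fun s n hn => by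
      rw [← lexLT_centered_iff, centered_signedTail he]
      exact hpeak s n hn
    have heq : piQ q e < 1 := by
      refine piQ_lt_one_of_seqLt hq ha ha1 (fun n => (htail n).1) he fun n => ?_
      rw [← lexLT_centered_iff]
      rcases Nat.eq_zero_or_pos n with rfl | hn
      · exact hlt
      · have h1 := hpeak' 1 n hn
        rw [signedTail_one] at h1
        exact (lexLT_centered_iff.2 h1).trans hlt
    obtain ⟨x, hx, hxU⟩ := exists_mem_univBases hr hrq hqM he hpeak' heq
      (hN e he fun i hi => centered_eq_iff.1 (hagree i hi))
    exact hU x hx hxU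

theorem dimH_eq_zero_of_peakFree (hM : 0 < M) {N₀ : ℕ}
    (h : PeakFree (centeredDigits M) (centered M '' tailsBelowOne M q) (centered M a) N₀) :
    dimH (piQ ((M : ℝ) + 1) '' {d ∈ tailsBelowOne M q | ∀ i < N₀, d i = a i}) = 0 := by
  have key : ∀ L : ℕ, 1 ≤ L →
      dimH (piQ ((M : ℝ) + 1) '' {d ∈ tailsBelowOne M q | ∀ i < N₀, d i = a i}) ≤
        (((L : NNReal)⁻¹ : NNReal) : ENNReal) := by
    intro L hL
    obtain ⟨N, hN, code, hcode⟩ := h.exists_code L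
    set F : Set (ℕ → ℕ) := {d ∈ tailsBelowOne M q | ∀ i < N, d i = a i} with hF
    set G : Set (ℕ → ℕ) :=
      {d | centered M d ∈ lowPeaks (centered M '' tailsBelowOne M q) (centered M a) N₀ N} with hG
    have hFdim : dimH (piQ ((M : ℝ) + 1) '' F) ≤ (((L : NNReal)⁻¹ : NNReal) : ENNReal) := by
      refine dimH_image_piQ_le hM hL (fun x hx => hx.1.1) (fun x => code (centered M x)) ?_
      intro x hx y hy k hk i hi
      exact centered_eq_iff.1 (hcode _ (mem_image_of_mem _ hx.1) _ (mem_image_of_mem _ hy.1)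
        (fun i hi => centered_eq_iff.2 (hx.2 i hi)) (fun i hi => centered_eq_iff.2 (hy.2 i hi))
        k hk i hi)
    have hGcount : G.Countable := by
      refine MapsTo.countable_of_injOn (f := fun d (i : Fin N) => d i) (t := univ)
        (fun _ _ => mem_univ _) (fun x hx y hy hxy => ?_) (to_countable _)
      exact centered_injective (h.eq_of_mem_lowPeaks hN hx hy fun i hi =>
        centered_eq_iff.2 (congrFun hxy ⟨i, hi⟩))
    calc _ ≤ dimH (piQ ((M : ℝ) + 1) '' (F ∪ G)) := by
          refine dimH_image_piQ_le_of_exists_signedTail hM fun d hd => ⟨hd.1.1, ?_⟩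
          obtain ⟨s, n, -, hsn⟩ := h.exists_signedShift_mem hN (mem_image_of_mem _ hd.1)
            fun i hi => centered_eq_iff.2 (hd.2 i hi)
          refine ⟨s, n, hsn.imp (fun hs => ?_) fun hs => ?_⟩
          · refine ⟨signedTail_mem_tailsBelowOne hd.1 s n, fun i hi => ?_⟩
            rw [← centered_eq_iff (M := M), centered_signedTail hd.1.1]
            exact hs i hi
          · rwa [hG, mem_ofPred_eq, centered_signedTail hd.1.1]
      _ ≤ _ := by
          rw [image_union, dimH_union, dimH_countable (hGcount.image _)]
          exact max_le hFdim zero_le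
  by_contra hne
  obtain ⟨L, hL⟩ := ENNReal.exists_inv_nat_lt hne
  have hL0 : L ≠ 0 := by
    rintro rfl
    simp at hL
  have := key L (Nat.one_le_iff_ne_zero.2 hL0)
  rw [ENNReal.coe_inv (by exact_mod_cast hL0), ENNReal.coe_natCast] at this
  exact absurd hL (not_lt.2 this)

theorem exists_tail_mem_tailsBelowOne (hp : 1 < p) (hq : 1 < q) (hc : ∀ i, c i ≤ M)
    (hpq : (M : ℝ) / (q - 1) < 2 → ∀ d : ℕ → ℕ, (∀ i, d i ≤ M) → 1 ≤ piQ p d →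
      piQ q (fun i => M - d i) < 1)
    (hpos : ∀ n m, c n < M → n < m → piQ q (fun i => c (i + m)) < 1)
    (hneg : ∀ n m, 0 < c n → n < m → piQ q (fun i => M - c (i + m)) < 1)
    {n : ℕ} (hn : c n < M) (hn1 : 1 ≤ piQ p fun i => c (i + (n + 1))) :
    ∃ m, signedTail M 1 m c ∈ tailsBelowOne M q ∧ 1 ≤ piQ p (signedTail M 1 m c) := by
  classical
  have hp0 : 0 < p := by linarith
  have hex : ∃ k, c (k + (n + 1)) ≠ 0 := by
    by_contra! h
    norm_num [piQ, h] at hn1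
  obtain ⟨k, hk0, hk⟩ : ∃ k, c (k + (n + 1)) ≠ 0 ∧ ∀ i < k, c (i + (n + 1)) = 0 :=
    ⟨Nat.find hex, Nat.find_spec hex, fun i hi => not_not.1 (Nat.find_min hex hi)⟩
  have hk1 : 1 ≤ piQ p fun i => c (i + (k + (n + 1))) := by
    rw [piQ_eq_sum_add hp (fun i => hc (i + (n + 1))) k,
      Finset.sum_eq_zero fun i hi => by rw [hk i (Finset.mem_range.1 hi)]; simp, zero_add,
      le_div_iff₀ (by positivity), one_mul] at hn1
    simp only [add_assoc] at hn1
    exact (one_le_pow₀ hp.le).trans hn1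
  have hk0' := Nat.pos_of_ne_zero hk0
  refine ⟨k + (n + 1), ⟨signedTail_le hc _ _, fun s i => ?_⟩, by rwa [signedTail_one]⟩
  rw [signedTail_signedTail hc, mul_one]
  rcases Int.units_eq_one_or s with rfl | rfl
  · rw [signedTail_one]
    exact hpos n _ hn (by omega)
  · rw [signedTail_neg_one]
    rcases Nat.eq_zero_or_pos i with rfl | hi
    · rw [zero_add]
      refine hpq ?_ _ (fun i => hc _) hk1
      have h1 := hpos n (k + (n + 1) + 1) hn (by omega)
      have h2 := hneg _ (k + (n + 1) + 1) hk0' (by omega)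
      have h3 := piQ_refl hq fun i => hc (i + (k + (n + 1) + 1))
      linarith
    · exact hneg _ _ hk0' (by omega)

theorem exists_signedTail_mem_tailsBelowOne (hM : 0 < M) (hp : 1 < p) (hq : 1 < q)
    (hqM : q ≤ M + 1)
    (hpq : (M : ℝ) / (q - 1) < 2 → ∀ d : ℕ → ℕ, (∀ i, d i ≤ M) → 1 ≤ piQ p d →
      piQ q (fun i => M - d i) < 1)
    (hcq : c ∈ UnivSeqs M q) (hcp : c ∉ UnivSeqs M p) :
    ∃ s n, signedTail M s n c ∈ tailsBelowOne M q ∧ 1 ≤ piQ p (signedTail M s n c) := by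
  have hc := hcq.1
  obtain ⟨n, ⟨hn, hn1⟩ | ⟨hn, hn1⟩⟩ := exists_tail_of_not_mem hp hc hcp
  · exact ⟨1, exists_tail_mem_tailsBelowOne hp hq hc hpq
      (fun _ _ => tail_lt_one_of_lt hq hqM hcq) (fun _ _ => refl_tail_lt_one_of_lt hq hqM hcq)
      hn hn1⟩
  · obtain ⟨m, hm⟩ := exists_tail_mem_tailsBelowOne (c := signedTail M (-1) 0 c) (n := n) hp hq
      (signedTail_le hc _ _) hpq
      (fun i m hi him => by
        simp only [signedTail_neg_one, add_zero] at hi ⊢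
        exact refl_tail_lt_one_of_lt hq hqM hcq (n := i) (by omega) him)
      (fun i m hi him => by
        simp only [signedTail_neg_one, add_zero, Nat.sub_sub_self (hc _)] at hi ⊢
        exact tail_lt_one_of_lt hq hqM hcq (n := i) (by omega) him)
      (by simp only [signedTail_neg_one, add_zero]; omega)
      (by simpa only [signedTail_neg_one, add_zero] using hn1)
    rw [signedTail_signedTail hc] at hm
    exact ⟨_, _, hm⟩

theorem eventually_prefix_eq (hq : 1 < q) (ha : ∀ i, a i ≤ M) (ha1 : piQ q a = 1)
    (htail : ∀ n, 0 < piQ q (fun i => a (i + n)) ∧ piQ q (fun i => a (i + n)) ≤ 1) (N : ℕ) :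
    ∀ᶠ p in nhdsWithin q (Iio q), ∀ d ∈ tailsBelowOne M q, 1 ≤ piQ p d →
      ∀ i < N, d i = a i := by
  have hq0 : 0 < q := by linarith
  have h : ∀ᶠ p in nhdsWithin q (Iio q), ∀ j ∈ Finset.range N, ∀ d : ℕ → ℕ, (∀ i, d i ≤ M) →
      piQ p d < piQ q d + piQ q (fun i => a (i + (j + 1))) / q ^ (j + 1) :=
    (Filter.eventually_all_finset _).2 fun j _ =>
      eventually_piQ_lt hq (div_pos (htail _).1 (by positivity))
  filter_upwards [h] with p hp d hd hd1 i hi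
  by_contra hne
  obtain ⟨j, hj, hne'⟩ := first_diff_nat (Function.ne_iff.2 ⟨i, hne⟩)
  have hji : j ≤ i := not_lt.1 fun hij => hne (hj i hij)
  have h1 := (lt_quasiGreedy hq ha ha1 (fun n => (htail n).2) hd.1 (tail_lt_one_of_mem hd)
    hj hne').2
  have h2 := hp j (Finset.mem_range.2 (by omega)) d hd.1
  linarith

theorem eventually_refl_lt_one (hq : 1 < q) :
    ∀ᶠ p in nhdsWithin q (Iio q), (M : ℝ) / (q - 1) < 2 → ∀ d : ℕ → ℕ, (∀ i, d i ≤ M) →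
      1 ≤ piQ p d → piQ q (fun i => M - d i) < 1 := by
  by_cases h2 : (M : ℝ) / (q - 1) < 2
  · filter_upwards [eventually_piQ_lt hq (sub_pos.2 h2)] with p hp _ d hd hd1
    have := hp d hd
    rw [piQ_refl hq hd]
    linarith
  · exact Eventually.of_forall fun _ h => absurd h h2

/-- If there are no univoque bases slightly below `q`, then `U'_q` is not much larger than `U'_p`
for some `p < q`. -/
theorem exists_dimH_diff_eq_zero (hM : 0 < M) {r : ℝ} (hr : 1 < r) (hrq : r < q)
    (hqM : q ≤ M + 1) (hU : ∀ x ∈ Ioo r q, x ∉ UnivBases M) :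
    ∃ p ∈ Ioo 1 q, dimH (piQ ((M : ℝ) + 1) '' (UnivSeqs M q \ UnivSeqs M p)) = 0 := by
  have hq : 1 < q := hr.trans hrq
  obtain ⟨a, ha, ha1, htail⟩ := exists_quasiGreedy hq hqM
  obtain ⟨N, hN⟩ := exists_peakFree hr hrq hqM hU ha ha1 htail
  have h1 : ∀ᶠ p in nhdsWithin q (Iio q), 1 < p :=
    (lt_mem_nhds hq).filter_mono nhdsWithin_le_nhds
  have h2 : ∀ᶠ p in nhdsWithin q (Iio q), p < q := self_mem_nhdsWithin
  obtain ⟨p, hp, hpq, hprefix, hrefl⟩ := (h1.and (h2.and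
    ((eventually_prefix_eq hq ha ha1 htail N).and
      (eventually_refl_lt_one (M := M) hq)))).exists
  refine ⟨p, ⟨hp, hpq⟩, nonpos_iff_eq_zero.1 ?_⟩
  rw [← dimH_eq_zero_of_peakFree hM hN]
  refine dimH_image_piQ_le_of_exists_signedTail hM fun c hc => ⟨hc.1.1, ?_⟩
  obtain ⟨s, n, hsn, hsn1⟩ :=
    exists_signedTail_mem_tailsBelowOne hM hp hq hqM hrefl hc.1 hc.2
  exact ⟨s, n, hsn, hprefix _ hsn hsn1⟩

end Gap

/-- If for every `p ∈ (1, q)` the Hausdorff dimension of `π_{M+1}(U'_q \ U'_p)`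
is strictly positive, then `q ∈ closure U`, `q ≠ q'`, and `q` is not the right
endpoint of any connected component of `(q', M+1) \ closure U`. -/
theorem stmt5 (M : ℕ) (hM : 0 < M) (q : ℝ) (hq : q ∈ Ioc 1 ((M : ℝ) + 1))
    (h : ∀ p ∈ Ioo (1 : ℝ) q,
      0 < dimH (piQ ((M : ℝ) + 1) '' (UnivSeqs M q \ UnivSeqs M p))) :
    q ∈ closure (UnivBases M) ∧ q ≠ KL M ∧ ¬∃ a : ℝ, CC M a q := by
  have key : ∀ r < q, ¬ ∀ x ∈ Ioo r q, x ∉ UnivBases M := by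
    intro r hr hU
    have hr1 : (1 + q) / 2 < q := by linarith [hq.1]
    have hr2 : 1 < (1 + q) / 2 := by linarith [hq.1]
    obtain ⟨p, hp, hp0⟩ := exists_dimH_diff_eq_zero hM (lt_max_of_lt_right hr2) (max_lt hr hr1)
      hq.2 fun x hx => hU x ⟨(le_max_left _ _).trans_lt hx.1, hx.2⟩
    exact (h p hp).ne' hp0
  refine ⟨?_, ?_, ?_⟩
  · by_contra hcl
    obtain ⟨r, hr, hsub⟩ := exists_Ioc_subset_of_mem_nhds
      (isClosed_closure.isOpen_compl.mem_nhds hcl) ⟨1, hq.1⟩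
    exact key r hr fun x hx hxU => hsub ⟨hx.1, hx.2.le⟩ (subset_closure hxU)
  · intro hKL
    refine key 1 hq.1 fun x hx hxU => ?_
    have : KL M ≤ x := csInf_le ⟨1, fun y hy => hy.1.le⟩ hxU
    linarith [hx.2]
  · rintro ⟨r, hr, hsub, -⟩
    exact key r hr fun x hx hxU => (hsub hx).2 (subset_closure hxU)

end
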